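/- Let δ ∈ (1,2), let V: ℝ^d → ℝ be continuous with ∫ e^{V(x)} dx = 1, and let μ(dx) = e^{V(x)} dx. Assume there is c > 0 such that the super Poincaré inequality ∫ f² dμ ≤ r ∫ |∇f|² dμ + exp[c(1 + r^{-1/δ})] (∫ |f| dμ)² holds for all r > 0 and all f ∈ C_c^∞(ℝ^d). Then there exists a constant C > 0 such that for every f ∈ C_c^∞(ℝ^d) with ∫ f² dμ = 1, one has ∫ f² log f² dμ ≤ C ∫ (1+|x|)^{-2(δ-1)/(2-δ)} |∇f(x)|² μ(dx). -/

import Mathlib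

open MeasureTheory Real Set

abbrev Eu (d : ℕ) := EuclideanSpace ℝ (Fin d)

noncomputable def rho {d : ℕ} (x : Eu d) : ℝ := √(1 + ‖x‖ ^ 2)

section basics
variable {d : ℕ}

lemma rho_sq (x : Eu d) : rho x ^ 2 = 1 + ‖x‖ ^ 2 := Real.sq_sqrt (by positivity)

lemma one_le_rho (x : Eu d) : 1 ≤ rho x := by
  unfold rho; rw [Real.one_le_sqrt]; nlinarith [sq_nonneg ‖x‖]

lemma rho_pos (x : Eu d) : 0 < rho x := lt_of_lt_of_le one_pos (one_le_rho x)

lemma norm_le_rho (x : Eu d) : ‖x‖ ≤ rho x := by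
  apply Real.le_sqrt_of_sq_le; linarith

lemma rho_le (x : Eu d) : rho x ≤ 1 + ‖x‖ := by
  unfold rho
  apply Real.sqrt_le_iff.2
  have := norm_nonneg x
  constructor
  · positivity
  · nlinarith

lemma one_add_norm_le (x : Eu d) : 1 + ‖x‖ ≤ 2 * rho x := by
  linarith [one_le_rho x, norm_le_rho x]

lemma rho_contDiff : ContDiff ℝ (⊤ : ℕ∞) (rho : Eu d → ℝ) := by
  unfold rho
  apply ContDiff.sqrt
  · exact contDiff_const.add (contDiff_norm_sq ℝ)
  · intro x; positivity

lemma rho_continuous : Continuous (rho : Eu d → ℝ) := rho_contDiff.continuous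

lemma fderiv_rho_sq (x : Eu d) : ‖fderiv ℝ (fun y : Eu d => rho y ^ 2) x‖ ≤ 2 * rho x := by
  have : (fun y : Eu d => rho y ^ 2) = fun y => 1 + ‖y‖ ^ 2 := by
    ext y; exact rho_sq y
  rw [this, fderiv_const_add, fderiv_norm_sq_apply]
  have h := norm_le_rho x
  rw [two_smul]
  refine le_trans (norm_add_le _ _) ?_
  rw [innerSL_apply_norm]
  linarith

lemma fderiv_rho_le (x : Eu d) : ‖fderiv ℝ (rho : Eu d → ℝ) x‖ ≤ 1 := by
  have h := fderiv_rho_sq x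
  have hd : DifferentiableAt ℝ (rho : Eu d → ℝ) x := (rho_contDiff.differentiable (by simp)) x
  have h2 : fderiv ℝ (fun y : Eu d => rho y ^ 2) x = (2 * rho x) • fderiv ℝ rho x := by
    rw [fderiv_fun_pow 2 hd]; simp
  rw [h2, norm_smul, Real.norm_of_nonneg (by linarith [rho_pos x])] at h
  have := rho_pos x
  by_contra hh
  push Not at hh
  nlinarith

/-- gradient norm -/
lemma norm_gradient (f : Eu d → ℝ) (x : Eu d) : ‖gradient f x‖ = ‖fderiv ℝ f x‖ := by
  unfold gradient; simp

lemma deriv_zero_of_min {f : ℝ → ℝ} (hf : ∀ x, 0 ≤ f x) {x : ℝ} (hx : f x = 0) :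
    deriv f x = 0 := by
  apply IsLocalMin.deriv_eq_zero
  exact Filter.Eventually.of_forall (fun y => by simp only [hx]; exact hf y)

lemma deriv_zero_of_max {f : ℝ → ℝ} (hf : ∀ x, f x ≤ 1) {x : ℝ} (hx : f x = 1) :
    deriv f x = 0 := by
  apply IsLocalMax.deriv_eq_zero
  exact Filter.Eventually.of_forall (fun y => by simp only [hx]; exact hf y)

lemma exists_bump (c r R : ℝ) (hr : 0 < r) (hrR : r < R) : ∃ θ : ℝ → ℝ, ContDiff ℝ (⊤ : ℕ∞) θ ∧
    (∀ t, 0 ≤ θ t) ∧ (∀ t, θ t ≤ 1) ∧ (∀ t, |t - c| ≤ r → θ t = 1) ∧ (∀ t, R ≤ |t - c| → θ t = 0)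
    ∧ (∀ t, R ≤ |t - c| → deriv θ t = 0) ∧ ∃ G > 0, ∀ t, |deriv θ t| ≤ G := by
  let b : ContDiffBump c := ⟨r, R, hr, hrR⟩
  have h0 : ∀ t, R ≤ |t - c| → b t = 0 := fun t ht => b.zero_of_le_dist (by simpa [Real.dist_eq] using ht)
  refine ⟨b, b.contDiff, fun t => b.nonneg, fun t => b.le_one, fun t ht => b.one_of_mem_closedBall
    (by simpa [Real.dist_eq] using ht), h0, fun t ht => deriv_zero_of_min (fun x => b.nonneg) (h0 t ht), ?_⟩
  have hc : Continuous (deriv b) := (b.contDiff (n := 1)).continuous_deriv (by simp)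
  obtain ⟨C, hC⟩ := hc.bounded_above_of_compact_support (b.hasCompactSupport.deriv)
  exact ⟨|C| + 1, by positivity, fun t => (hC t).trans (by linarith [le_abs_self C])⟩

lemma smoothTransition_deriv_bdd : ∃ G > 0, ∀ t, |deriv Real.smoothTransition t| ≤ G := by
  have hc : Continuous (deriv Real.smoothTransition) :=
    (Real.smoothTransition.contDiff (n := 1)).continuous_deriv (by simp)
  obtain ⟨C, hC⟩ := (isCompact_Icc (a := (0:ℝ)) (b := 1)).exists_bound_of_continuousOn hc.continuousOn
  refine ⟨|C| + 1, by positivity, fun t => ?_⟩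
  by_cases h0 : t < 0
  · rw [deriv_zero_of_min (Real.smoothTransition.nonneg) (Real.smoothTransition.zero_of_nonpos h0.le)]
    simp; positivity
  by_cases h1 : 1 < t
  · rw [deriv_zero_of_max (Real.smoothTransition.le_one) (Real.smoothTransition.one_of_one_le h1.le)]
    simp; positivity
  exact (hC t ⟨by linarith, by linarith⟩).trans (by linarith [le_abs_self C])

lemma norm_fderiv_comp {θ : ℝ → ℝ} {u : Eu d → ℝ} (hθ : ContDiff ℝ (⊤ : ℕ∞) θ)
    (hu : ContDiff ℝ (⊤ : ℕ∞) u) (x : Eu d) :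
    ‖fderiv ℝ (fun y => θ (u y)) x‖ = |deriv θ (u x)| * ‖fderiv ℝ u x‖ := by
  have h1 : HasDerivAt θ (deriv θ (u x)) (u x) := ((hθ.differentiable (by simp)) _).hasDerivAt
  have h2 : HasFDerivAt u (fderiv ℝ u x) x := ((hu.differentiable (by simp)) _).hasFDerivAt
  have := h1.comp_hasFDerivAt x h2
  have h3 : fderiv ℝ (fun y => θ (u y)) x = deriv θ (u x) • fderiv ℝ u x := this.fderiv
  rw [h3, norm_smul, Real.norm_eq_abs]

lemma overlap (t : ℝ) (N : ℕ) :
    ∑ k ∈ Finset.range N, (Icc ((4:ℝ)^k/2) (9/2*4^k)).indicator (fun _ => (1:ℝ)) t ≤ 2 := by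
  simp only [Set.indicator_apply]
  rw [Finset.sum_ite, Finset.sum_const_zero, add_zero, Finset.sum_const, nsmul_eq_mul, mul_one]
  set S := Finset.filter (fun k => t ∈ Icc ((4:ℝ)^k/2) (9/2*4^k)) (Finset.range N) with hS
  rcases S.eq_empty_or_nonempty with h | h
  · rw [h]; simp
  · have hsub : S ⊆ Finset.Icc (S.min' h) (S.min' h + 1) := by
      intro k hk
      rw [Finset.mem_Icc]
      refine ⟨S.min'_le k hk, ?_⟩
      by_contra hlt
      push Not at hlt
      have h1 := (Finset.mem_filter.1 (S.min'_mem h)).2.2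
      have h2 := (Finset.mem_filter.1 hk).2.1
      have h3 : (4:ℝ)^(S.min' h + 2) ≤ 4 ^ k := pow_le_pow_right₀ (by norm_num) (by omega)
      have h4 : (0:ℝ) < 4 ^ (S.min' h) := by positivity
      rw [pow_add] at h3
      nlinarith
    have := Finset.card_le_card hsub
    simp at this
    exact_mod_cast (by omega : S.card ≤ 2)

lemma sum_overlap {μ : Measure (Eu d)} {F u : Eu d → ℝ} (hF : ∀ x, 0 ≤ F x) (hi : Integrable F μ)
    (hu : Continuous u) (N : ℕ) :
    ∑ k ∈ Finset.range N, ∫ x in {x | u x ∈ Icc ((4:ℝ)^k/2) (9/2*4^k)}, F x ∂μ ≤ 2 * ∫ x, F x ∂μ := by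
  have hm : ∀ k : ℕ, MeasurableSet {x | u x ∈ Icc ((4:ℝ)^k/2) (9/2*4^k)} := fun k =>
    hu.measurable measurableSet_Icc
  have : ∀ k ∈ Finset.range N, ∫ x in {x | u x ∈ Icc ((4:ℝ)^k/2) (9/2*4^k)}, F x ∂μ
      = ∫ x, ({x | u x ∈ Icc ((4:ℝ)^k/2) (9/2*4^k)}).indicator F x ∂μ := fun k _ =>
    (integral_indicator (hm k)).symm
  rw [Finset.sum_congr rfl this, ← integral_finsetSum _ (fun k _ => hi.indicator (hm k)),
    ← integral_const_mul]
  apply integral_mono (integrable_finsetSum _ (fun k _ => hi.indicator (hm k))) (hi.const_mul 2)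
  intro x
  have h := overlap (u x) N
  calc _ = (∑ k ∈ Finset.range N, (Icc ((4:ℝ)^k/2) (9/2*4^k)).indicator (fun _ => (1:ℝ)) (u x)) * F x := by
        rw [Finset.sum_mul]
        apply Finset.sum_congr rfl
        intro k _
        simp only [Set.indicator_apply, mem_ofPred_eq]
        split_ifs <;> simp
    _ ≤ _ := mul_le_mul_of_nonneg_right h (hF x)

lemma cs_supp {μ : Measure (Eu d)} [IsFiniteMeasure μ] {g : Eu d → ℝ} (hg : Continuous g)
    (h1 : Integrable g μ) (h2 : Integrable (fun x => g x ^ 2) μ) :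
    (∫ x, |g x| ∂μ) ^ 2 ≤ μ.real {x | g x ≠ 0} * ∫ x, g x ^ 2 ∂μ := by
  have hm : MeasurableSet {x | g x ≠ 0} := (isOpen_ne_fun hg continuous_const).measurableSet
  have key : ∀ t : ℝ, 0 ≤ μ.real {x | g x ≠ 0} * (t * t) + (-2 * ∫ x, |g x| ∂μ) * t + ∫ x, g x ^ 2 ∂μ := by
    intro t
    have h3 : 0 ≤ ∫ x, (({x | g x ≠ 0}).indicator (fun _ => t*t) x + ((-2*t) * |g x| + g x ^ 2)) ∂μ := by
      apply integral_nonneg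
      intro x
      by_cases hx : g x = 0
      · simp [hx]
      · simp only [Pi.zero_apply, Set.indicator_apply, mem_ofPred_eq, ne_eq, hx, not_false_eq_true, if_true]
        nlinarith [sq_nonneg (t - |g x|), sq_abs (g x)]
    have h4 : Integrable (fun x => (-2*t) * |g x| + g x ^ 2) μ := (h1.abs.const_mul _).add h2
    rw [integral_add ((integrable_const _).indicator hm) h4,
      integral_add (h1.abs.const_mul _) h2, integral_indicator hm] at h3
    simp only [integral_const_mul, integral_const, smul_eq_mul, measureReal_restrict_apply_univ] at h3
    linarith
  have := discrim_le_zero key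
  unfold discrim at this
  linarith

end basics

def SP {d : ℕ} (μ : Measure (Eu d)) (c δ : ℝ) : Prop :=
  ∀ r > (0:ℝ), ∀ f : Eu d → ℝ, ContDiff ℝ (⊤ : ℕ∞) f → HasCompactSupport f →
      ∫ x, f x ^ 2 ∂μ ≤ r * ∫ x, ‖fderiv ℝ f x‖ ^ 2 ∂μ
        + Real.exp (c * (1 + r ^ (-(1:ℝ)/δ))) * (∫ x, |f x| ∂μ) ^ 2

noncomputable def Fn {d : ℕ} (p : ℝ) (h : Eu d → ℝ) (x : Eu d) : ℝ :=
  rho x ^ (-(p-2)) * ‖fderiv ℝ h x‖ ^ 2 + h x ^ 2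

section core
variable {d : ℕ}

lemma Fn_nonneg (p : ℝ) (h : Eu d → ℝ) (x : Eu d) : 0 ≤ Fn p h x := by
  unfold Fn
  have := rho_pos x
  positivity

lemma rho_rpow_continuous (q : ℝ) : Continuous (fun x : Eu d => rho x ^ q) :=
  rho_continuous.rpow_const (fun x => Or.inl (rho_pos x).ne')

lemma Fn_continuous (p : ℝ) {h : Eu d → ℝ} (hh : ContDiff ℝ (⊤ : ℕ∞) h) : Continuous (Fn p h) := by
  unfold Fn
  have h1 : Continuous (fderiv ℝ h) := hh.continuous_fderiv (by simp)
  exact ((rho_rpow_continuous _).mul (h1.norm.pow 2)).add (hh.continuous.pow 2)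

lemma int_sq {μ : Measure (Eu d)} [IsFiniteMeasure μ] {g : Eu d → ℝ} (hg : Continuous g)
    (hc : HasCompactSupport g) : Integrable (fun x => g x ^ 2) μ := by
  have h1 : HasCompactSupport (fun x => g x ^ 2) := hc.comp_left (g := fun t : ℝ => t ^ 2) (by simp)
  have h2 : Continuous (fun x => g x ^ 2) := hg.pow 2
  exact h2.integrable_of_hasCompactSupport h1

lemma expo_facts {δ p : ℝ} (hδ : δ ∈ Ioo (1:ℝ) 2) (hp : p = 2 / (2 - δ)) :
    2 < p ∧ p * δ = p + (p - 2) := by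
  obtain ⟨h1, h2⟩ := hδ
  have h3 : 0 < 2 - δ := by linarith
  constructor
  · rw [hp, lt_div_iff₀ h3]; linarith
  · rw [hp]; field_simp; ring

set_option maxHeartbeats 1000000 in
lemma core {μ : Measure (Eu d)} [IsProbabilityMeasure μ] {c δ p : ℝ} (hc : 0 < c)
    (hδ : δ ∈ Ioo (1:ℝ) 2) (hp : p = 2 / (2 - δ)) (hSP : SP μ c δ)
    {A ε G : ℝ} (hA : 1 ≤ A) (hε : 0 < ε) (hG : 0 ≤ G) :
    ∃ C > 0, ∀ R ≥ (1:ℝ), ∀ (χ h : Eu d → ℝ) (S : Set (Eu d)), ContDiff ℝ (⊤ : ℕ∞) χ →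
      ContDiff ℝ (⊤ : ℕ∞) h → MeasurableSet S → (∀ x, |χ x| ≤ 1) → (∀ x ∉ S, χ x = 0) →
      (∀ x ∉ S, fderiv ℝ χ x = 0) → (∀ x, ‖fderiv ℝ χ x‖ ≤ G / R) → (∀ x ∈ S, rho x ≤ 4 * R) →
      μ.real {x | χ x * h x ≠ 0} ≤ A * Real.exp (-ε * R ^ p) →
      R ^ p * ∫ x, (χ x * h x) ^ 2 ∂μ ≤ C * ∫ x in S, Fn p h x ∂μ := by
  classical
  obtain ⟨hp2, hpδ⟩ := expo_facts hδ hp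
  have hδ0 : 0 < δ := by linarith [hδ.1]
  set b : ℝ := (2 * c / ε) ^ δ with hb
  have hbpos : 0 < b := by positivity
  set R0 : ℝ := 2 / ε * (c + Real.log (2 * A)) with hR0
  have hlog : 0 ≤ Real.log (2 * A) := Real.log_nonneg (by linarith)
  have hR0pos : 0 < R0 := by positivity
  refine ⟨R0 + 4 * b * (4 ^ (p-2) + G ^ 2), by positivity, ?_⟩
  intro R hR χ h S hχ hh hS hχ1 hχ0 hdχ0 hdχ hSR hμ
  have hRpos : 0 < R := by linarith
  have hg : ContDiff ℝ (⊤ : ℕ∞) (fun x => χ x * h x) := hχ.mul hh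
  have hgc : HasCompactSupport (fun x => χ x * h x) := by
    apply HasCompactSupport.intro (isCompact_closedBall (0 : Eu d) (4 * R))
    intro x hx
    rw [hχ0 x, zero_mul]
    intro hxS
    apply hx
    simp only [Metric.mem_closedBall, dist_zero_right]
    exact (norm_le_rho x).trans (hSR x hxS)
  have hFi : IntegrableOn (Fn p h) S μ := by
    apply IntegrableOn.mono_set (t := Metric.closedBall (0 : Eu d) (4 * R))
    · exact (Fn_continuous p hh).continuousOn.integrableOn_compact (isCompact_closedBall _ _)
    · intro x hx
      simp only [Metric.mem_closedBall, dist_zero_right]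
      exact (norm_le_rho x).trans (hSR x hx)
  have hg1 : Integrable (fun x => χ x * h x) μ := hg.continuous.integrable_of_hasCompactSupport hgc
  have hg2 : Integrable (fun x => (χ x * h x)^2) μ := int_sq hg.continuous hgc
  have hFnn : 0 ≤ ∫ x in S, Fn p h x ∂μ := setIntegral_nonneg hS (fun x _ => Fn_nonneg p h x)
  by_cases hcase : R ^ p < R0
  · have h1 : ∫ x, (χ x * h x) ^ 2 ∂μ ≤ ∫ x in S, Fn p h x ∂μ := by
      rw [← integral_indicator hS]
      apply integral_mono hg2 (hFi.integrable_indicator hS)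
      intro x
      simp only [Set.indicator_apply]
      split_ifs with hx
      · have h2 : h x ^ 2 ≤ Fn p h x := by
          unfold Fn
          have := rho_pos x
          have : 0 ≤ rho x ^ (-(p-2)) * ‖fderiv ℝ h x‖ ^ 2 := by positivity
          linarith
        have h3 : χ x ^ 2 ≤ 1 := by
          have := hχ1 x
          rw [← sq_abs]; nlinarith [abs_nonneg (χ x)]
        calc (χ x * h x) ^ 2 = χ x ^ 2 * h x ^ 2 := by ring
          _ ≤ 1 * h x ^ 2 := by gcongr
          _ ≤ _ := by linarith
      · simp [hχ0 x hx]
    have h0 : 0 ≤ ∫ x, (χ x * h x) ^ 2 ∂μ := integral_nonneg (fun x => sq_nonneg _)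
    calc R ^ p * ∫ x, (χ x * h x) ^ 2 ∂μ ≤ R0 * ∫ x in S, Fn p h x ∂μ := by gcongr
      _ ≤ _ := by
        apply mul_le_mul_of_nonneg_right _ hFnn
        have : 0 ≤ 4 * b * (4 ^ (p-2) + G ^ 2) := by positivity
        linarith
  push Not at hcase
  set r : ℝ := b * R ^ (-(p * δ)) with hr
  have hrpos : 0 < r := by positivity
  have hr1 : c * r ^ (-(1:ℝ)/δ) = ε / 2 * R ^ p := by
    rw [hr, Real.mul_rpow hbpos.le (by positivity), hb, ← Real.rpow_mul (by positivity),
      ← Real.rpow_mul (by positivity)]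
    rw [show δ * (-1 / δ) = -1 by field_simp, show -(p * δ) * (-1 / δ) = p by field_simp,
      Real.rpow_neg_one]
    field_simp
  have hβ : Real.exp (c * (1 + r ^ (-(1:ℝ)/δ))) * (A * Real.exp (-ε * R ^ p)) ≤ 1 / 2 := by
    have hApos : 0 < A := by linarith
    have : A = Real.exp (Real.log (2 * A)) / 2 := by rw [Real.exp_log (by positivity)]; ring
    rw [this, mul_add, hr1]
    have e0 : ∀ a b c : ℝ, Real.exp a * (Real.exp b / 2 * Real.exp c) = Real.exp (a + b + c) / 2 := by
      intro a b c; rw [Real.exp_add, Real.exp_add]; ring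
    rw [e0]
    apply div_le_div_of_nonneg_right _ (by norm_num)
    rw [Real.exp_le_one_iff]
    have h5 : c + Real.log (2 * A) ≤ ε / 2 * R ^ p := by
      have : c + Real.log (2 * A) = ε / 2 * R0 := by rw [hR0]; field_simp
      rw [this]; gcongr
    linarith
  have hsp := hSP r hrpos _ hg hgc
  have hcs := cs_supp hg.continuous hg1 hg2
  set Q := ∫ x, (χ x * h x) ^ 2 ∂μ with hQ
  have hQ0 : 0 ≤ Q := integral_nonneg (fun x => sq_nonneg _)
  have hlast : Real.exp (c * (1 + r ^ (-(1:ℝ)/δ))) * (∫ x, |χ x * h x| ∂μ) ^ 2 ≤ 1 / 2 * Q := by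
    calc _ ≤ Real.exp (c * (1 + r ^ (-(1:ℝ)/δ))) * ((A * Real.exp (-ε * R ^ p)) * Q) := by
          gcongr
          exact hcs.trans (by gcongr)
      _ = (Real.exp (c * (1 + r ^ (-(1:ℝ)/δ))) * (A * Real.exp (-ε * R ^ p))) * Q := by ring
      _ ≤ _ := by gcongr
  set D := ∫ x, ‖fderiv ℝ (fun x => χ x * h x) x‖ ^ 2 ∂μ with hD
  have hQD : Q ≤ 2 * r * D := by linarith
  have hRr : R ^ p * r = b * R ^ (-(p-2)) := by
    rw [hr, mul_left_comm, ← Real.rpow_add hRpos, hpδ]; congr 2; ring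
  have hD2 : R ^ (-(p-2)) * D ≤ 2 * (4 ^ (p-2) + G ^ 2) * ∫ x in S, Fn p h x ∂μ := by
    rw [hD, ← integral_const_mul, ← integral_const_mul, ← integral_indicator hS]
    apply integral_mono_of_nonneg
    · exact Filter.Eventually.of_forall (fun x => by simp only [Pi.zero_apply]; positivity)
    · exact (show IntegrableOn _ S μ from Integrable.const_mul hFi _).integrable_indicator hS
    refine Filter.Eventually.of_forall (fun x => ?_)
    have hder : fderiv ℝ (fun x => χ x * h x) x = χ x • fderiv ℝ h x + h x • fderiv ℝ χ x :=
      fderiv_fun_mul (hχ.differentiable (by simp) x) (hh.differentiable (by simp) x)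
    simp only [Set.indicator_apply]
    split_ifs with hx
    · have h1 : ‖fderiv ℝ (fun x => χ x * h x) x‖ ≤ ‖fderiv ℝ h x‖ + |h x| * (G / R) := by
        rw [hder]
        refine (norm_add_le _ _).trans ?_
        rw [norm_smul, norm_smul, Real.norm_eq_abs, Real.norm_eq_abs]
        have h2 := hχ1 x
        have h3 := hdχ x
        calc _ ≤ 1 * ‖fderiv ℝ h x‖ + |h x| * (G / R) := by gcongr
          _ = _ := by ring
      have h4 : ‖fderiv ℝ (fun x => χ x * h x) x‖ ^ 2 ≤ 2 * (‖fderiv ℝ h x‖ ^ 2 + (G/R)^2 * h x ^ 2) := by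
        have : ‖fderiv ℝ (fun x => χ x * h x) x‖ ^ 2 ≤ (‖fderiv ℝ h x‖ + |h x| * (G / R)) ^ 2 := by gcongr
        refine this.trans ?_
        rw [← sq_abs (h x)]
        nlinarith [sq_nonneg (‖fderiv ℝ h x‖ - |h x| * (G / R))]
      have h5 : R ^ (-(p-2)) ≤ 4 ^ (p-2) * rho x ^ (-(p-2)) := by
        have h6 := hSR x hx
        have h7 := rho_pos x
        calc R ^ (-(p-2)) = 4 ^ (p-2) * (4 * R) ^ (-(p-2)) := by
              rw [Real.mul_rpow (by norm_num) hRpos.le, ← mul_assoc, ← Real.rpow_add (by norm_num)]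
              simp
          _ ≤ _ := by
            apply mul_le_mul_of_nonneg_left _ (by positivity)
            exact Real.rpow_le_rpow_of_nonpos h7 h6 (by linarith)
      have h8 : R ^ (-(p-2)) * (G/R)^2 ≤ G ^ 2 := by
        have h9 : R ^ (-(p-2)) ≤ 1 := Real.rpow_le_one_of_one_le_of_nonpos hR (by linarith)
        have h10 : (G / R) ^ 2 ≤ G ^ 2 := by
          gcongr
          exact div_le_self hG hR
        calc _ ≤ 1 * G ^ 2 := by gcongr
          _ = _ := one_mul _
      unfold Fn
      have h11 := rho_pos x
      set P := rho x ^ (-(p-2)) with hP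
      have hPpos : 0 < P := by positivity
      calc R ^ (-(p-2)) * ‖fderiv ℝ (fun x => χ x * h x) x‖ ^ 2
          ≤ R ^ (-(p-2)) * (2 * (‖fderiv ℝ h x‖ ^ 2 + (G/R)^2 * h x ^ 2)) := by gcongr
        _ = 2 * (R ^ (-(p-2)) * ‖fderiv ℝ h x‖ ^ 2 + (R ^ (-(p-2)) * (G/R)^2) * h x ^ 2) := by ring
        _ ≤ 2 * ((4 ^ (p-2) * P) * ‖fderiv ℝ h x‖ ^ 2 + G ^ 2 * h x ^ 2) := by gcongr
        _ ≤ _ := by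
          have e1 : 0 ≤ (4:ℝ) ^ (p-2) * h x ^ 2 := by positivity
          have e2 : 0 ≤ G ^ 2 * (P * ‖fderiv ℝ h x‖ ^ 2) := by positivity
          linarith
    · rw [hder, hχ0 x hx, hdχ0 x hx]; simp
  calc R ^ p * Q ≤ R ^ p * (2 * r * D) := by gcongr
    _ = 2 * b * (R ^ (-(p-2)) * D) := by rw [← mul_assoc, mul_left_comm, hRr]; ring
    _ ≤ 2 * b * (2 * (4 ^ (p-2) + G ^ 2) * ∫ x in S, Fn p h x ∂μ) := by gcongr
    _ = (4 * b * (4 ^ (p-2) + G ^ 2)) * ∫ x in S, Fn p h x ∂μ := by ring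
    _ ≤ _ := by
      apply mul_le_mul_of_nonneg_right _ hFnn
      linarith

end core

section conc
variable {d : ℕ}

lemma rho_tail_tendsto {μ : Measure (Eu d)} [IsProbabilityMeasure μ] :
    Filter.Tendsto (fun n : ℕ => μ.real {x : Eu d | (n:ℝ) ≤ rho x}) Filter.atTop (nhds 0) := by
  have hmeas : ∀ t : ℝ, MeasurableSet {x : Eu d | t ≤ rho x} := fun t =>
    (isClosed_le continuous_const rho_continuous).measurableSet
  have h1 : Filter.Tendsto (fun n : ℕ => μ {x : Eu d | (n:ℝ) ≤ rho x}) Filter.atTop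
      (nhds (μ (⋂ n : ℕ, {x : Eu d | (n:ℝ) ≤ rho x}))) := by
    apply tendsto_measure_iInter_atTop
    · exact fun n => (hmeas n).nullMeasurableSet
    · intro m n hmn x hx
      simp only [mem_ofPred_eq] at hx ⊢
      exact le_trans (by exact_mod_cast hmn) hx
    · exact ⟨0, measure_ne_top _ _⟩
  have h2 : (⋂ n : ℕ, {x : Eu d | (n:ℝ) ≤ rho x}) = ∅ := by
    ext x
    simp only [mem_iInter, mem_empty_iff_false, iff_false, not_forall]
    obtain ⟨n, hn⟩ := exists_nat_gt (rho x)
    exact ⟨n, fun h => absurd hn (not_lt.2 h)⟩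
  rw [h2, measure_empty] at h1
  have := (ENNReal.tendsto_toReal ENNReal.zero_ne_top).comp h1
  simpa [Function.comp_def, Measure.real] using this

set_option maxHeartbeats 1000000 in
lemma conc_step {μ : Measure (Eu d)} [IsProbabilityMeasure μ] {c δ : ℝ} (hSP : SP μ c δ)
    {G : ℝ} (hG : 0 < G) (hGb : ∀ t, |deriv Real.smoothTransition t| ≤ G)
    {s η r : ℝ} (hη : 0 < η) (hr : 0 < r) :
    μ.real {x | s + η ≤ rho x} ≤ r * (G / η) ^ 2 * (μ.real {x | s ≤ rho x} - μ.real {x | s + η ≤ rho x})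
      + Real.exp (c * (1 + r ^ (-(1:ℝ)/δ))) * μ.real {x | s ≤ rho x} ^ 2 := by
  have hmeas : ∀ t : ℝ, MeasurableSet {x : Eu d | t ≤ rho x} := fun t =>
    (isClosed_le continuous_const rho_continuous).measurableSet
  have hlim := rho_tail_tendsto (μ := μ)
  set us := μ.real {x : Eu d | s ≤ rho x} with hus
  set ut := μ.real {x : Eu d | s + η ≤ rho x} with hut
  have key : ∀ n : ℕ, s + η ≤ n → ut - μ.real {x : Eu d | (n:ℝ) ≤ rho x} ≤
      r * ((G / η) ^ 2 * (us - ut) + G ^ 2 * μ.real {x : Eu d | (n:ℝ) ≤ rho x})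
      + Real.exp (c * (1 + r ^ (-(1:ℝ)/δ))) * us ^ 2 := by
    intro n hn
    set T := Real.smoothTransition with hT
    have hTc : ContDiff ℝ (⊤ : ℕ∞) T := Real.smoothTransition.contDiff
    set H : ℝ → ℝ := fun t => T ((t - s) / η) * T (n + 1 - t) with hH
    have hHc : ContDiff ℝ (⊤ : ℕ∞) H := by
      apply ContDiff.mul
      · exact hTc.comp ((contDiff_id.sub contDiff_const).div_const _)
      · exact hTc.comp (contDiff_const.sub contDiff_id)
    have hT0 : ∀ t, 0 ≤ T t := Real.smoothTransition.nonneg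
    have hT1 : ∀ t, T t ≤ 1 := Real.smoothTransition.le_one
    have hder : ∀ t, deriv H t = deriv T ((t-s)/η) / η * T (n+1-t) - T ((t-s)/η) * deriv T (n+1-t) := by
      intro t
      have e1 : HasDerivAt (fun t => T ((t - s) / η)) (deriv T ((t-s)/η) * (1 / η)) t := by
        have a1 : HasDerivAt T (deriv T ((t-s)/η)) ((t-s)/η) := (hTc.differentiable (by simp) _).hasDerivAt
        have a2 : HasDerivAt (fun t => (t - s)/η) (1 / η) t := ((hasDerivAt_id t).sub_const s).div_const η
        exact a1.comp t a2
      have e2 : HasDerivAt (fun t => T (n + 1 - t)) (deriv T (n+1-t) * (-1)) t := by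
        have a1 : HasDerivAt T (deriv T (n+1-t)) (n+1-t) := (hTc.differentiable (by simp) _).hasDerivAt
        have a2 : HasDerivAt (fun t => (n:ℝ) + 1 - t) (-1) t := (hasDerivAt_id t).const_sub _
        exact a1.comp t a2
      have e3 : HasDerivAt H _ t := e1.mul e2
      rw [e3.deriv]; ring
    have hd0 : ∀ t ≤ 0, deriv T t = 0 := fun t ht =>
      deriv_zero_of_min hT0 (Real.smoothTransition.zero_of_nonpos ht)
    have hd1 : ∀ t ≥ 1, deriv T t = 0 := fun t ht =>
      deriv_zero_of_max hT1 (Real.smoothTransition.one_of_one_le ht)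
    have hf : ContDiff ℝ (⊤ : ℕ∞) (fun x : Eu d => H (rho x)) := hHc.comp rho_contDiff
    have hfc : HasCompactSupport (fun x : Eu d => H (rho x)) := by
      apply HasCompactSupport.intro (isCompact_closedBall (0 : Eu d) (n+1))
      intro x hx
      simp only [Metric.mem_closedBall, dist_zero_right, not_le] at hx
      have : T (n + 1 - rho x) = 0 :=
        Real.smoothTransition.zero_of_nonpos (by linarith [norm_le_rho x])
      simp [hH, this]
    have hH0 : ∀ t, 0 ≤ H t := fun t => mul_nonneg (hT0 _) (hT0 _)
    have hH1 : ∀ t, H t ≤ 1 := fun t => mul_le_one₀ (hT1 _) (hT0 _) (hT1 _)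
    have hsp := hSP r hr _ hf hfc
    have hi2 : Integrable (fun x : Eu d => H (rho x) ^ 2) μ := int_sq hf.continuous hfc
    have hi1 : ∀ t : ℝ, Integrable (({x : Eu d | t ≤ rho x}).indicator (fun _ => (1:ℝ))) μ := fun t =>
      (integrable_const _).indicator (hmeas t)
    have hin : ∀ t : ℝ, ∫ x, ({x : Eu d | t ≤ rho x}).indicator (fun _ => (1:ℝ)) x ∂μ
        = μ.real {x : Eu d | t ≤ rho x} := fun t => by
      rw [integral_indicator (hmeas t)]; simp
    have hL : ut - μ.real {x : Eu d | (n:ℝ) ≤ rho x} ≤ ∫ x, H (rho x) ^ 2 ∂μ := by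
      rw [hut, ← hin, ← hin, ← integral_sub (hi1 _) (hi1 _)]
      apply integral_mono ((hi1 _).sub (hi1 _)) hi2
      intro x
      simp only [Pi.sub_apply, Set.indicator_apply, mem_ofPred_eq]
      have := sq_nonneg (H (rho x))
      split_ifs with h1 h2 h2
      · linarith
      · have e1 : T ((rho x - s)/η) = 1 := Real.smoothTransition.one_of_one_le (by
          rw [le_div_iff₀ hη]; linarith)
        have e2 : T (n + 1 - rho x) = 1 := Real.smoothTransition.one_of_one_le (by linarith)
        simp [hH, e1, e2]
      · linarith
      · linarith
    have hI : ∫ x, |H (rho x)| ∂μ ≤ us := by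
      rw [hus, ← hin]
      apply integral_mono (hf.continuous.integrable_of_hasCompactSupport hfc).abs (hi1 _)
      intro x
      simp only [Set.indicator_apply, mem_ofPred_eq, abs_of_nonneg (hH0 _)]
      split_ifs with h1
      · exact hH1 _
      · have e1 : T ((rho x - s)/η) = 0 := Real.smoothTransition.zero_of_nonpos (by
          apply div_nonpos_of_nonpos_of_nonneg <;> linarith)
        simp [hH, e1]
    have hI0 : 0 ≤ ∫ x, |H (rho x)| ∂μ := integral_nonneg (fun x => abs_nonneg _)
    have hDb : ∫ x, ‖fderiv ℝ (fun x : Eu d => H (rho x)) x‖ ^ 2 ∂μ ≤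
        (G / η) ^ 2 * (us - ut) + G ^ 2 * μ.real {x : Eu d | (n:ℝ) ≤ rho x} := by
      have hii : Integrable (fun a => (G / η) ^ 2 * (({x : Eu d | s ≤ rho x}).indicator (fun x => (1:ℝ)) a
          - ({x : Eu d | s + η ≤ rho x}).indicator (fun x => (1:ℝ)) a)) μ := ((hi1 s).sub (hi1 (s+η))).const_mul ((G/η)^2)
      have hij : Integrable (fun a => G ^ 2 * ({x : Eu d | (n:ℝ) ≤ rho x}).indicator (fun x => (1:ℝ)) a) μ :=
        (hi1 n).const_mul (G^2)
      rw [hus, hut, ← hin, ← hin, ← hin, ← integral_sub (hi1 _) (hi1 _), ← integral_const_mul,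
        ← integral_const_mul, ← integral_add hii hij]
      apply integral_mono_of_nonneg
      · exact Filter.Eventually.of_forall (fun x => by simp only [Pi.zero_apply]; positivity)
      · exact hii.add hij
      refine Filter.Eventually.of_forall (fun x => ?_)
      have hb1 : ‖fderiv ℝ (fun x : Eu d => H (rho x)) x‖ ≤ |deriv H (rho x)| := by
        rw [norm_fderiv_comp hHc rho_contDiff]
        exact mul_le_of_le_one_right (abs_nonneg _) (fderiv_rho_le x)
      have hb2 : ‖fderiv ℝ (fun x : Eu d => H (rho x)) x‖ ^ 2 ≤ |deriv H (rho x)| ^ 2 := by gcongr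
      refine hb2.trans ?_
      rw [hder]
      set t := rho x with ht
      simp only [Set.indicator_apply, mem_ofPred_eq, ← ht]
      by_cases c1 : s ≤ t
      · by_cases c2 : s + η ≤ t
        · rw [hd1 ((t-s)/η) (by rw [ge_iff_le, le_div_iff₀ hη]; linarith)]
          by_cases c3 : (n:ℝ) ≤ t
          · simp only [c1, c2, c3, if_true]
            have : |0 / η * T (n + 1 - t) - T ((t - s) / η) * deriv T (n + 1 - t)| ≤ G := by
              rw [zero_div, zero_mul, zero_sub, abs_neg, abs_mul, abs_of_nonneg (hT0 _)]
              calc _ ≤ 1 * G := by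
                    gcongr
                    · exact hT1 _
                    · exact hGb _
                _ = G := one_mul _
            have h6 : |0 / η * T (n + 1 - t) - T ((t - s) / η) * deriv T (n + 1 - t)| ^ 2 ≤ G ^ 2 := by gcongr
            linarith
          · simp only [c1, c2, c3, if_true, if_false]
            rw [hd1 (n+1-t) (by linarith)]
            simp
        · have c3 : ¬ (n:ℝ) ≤ t := by linarith
          simp only [c1, c2, c3, if_true, if_false]
          rw [hd1 (n+1-t) (by linarith)]
          have : |deriv T ((t - s) / η) / η * T (n + 1 - t) - T ((t - s) / η) * 0| ≤ G / η := by
            rw [mul_zero, sub_zero, abs_mul, abs_of_nonneg (hT0 _), abs_div, abs_of_pos hη]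
            calc _ ≤ G / η * 1 := by
                  gcongr
                  · exact hT0 _
                  · exact hGb _
                  · exact hT1 _
              _ = _ := mul_one _
          have h6 : |deriv T ((t - s) / η) / η * T (n + 1 - t) - T ((t - s) / η) * 0| ^ 2 ≤ (G / η) ^ 2 := by gcongr
          linarith
      · have c2 : ¬ s + η ≤ t := by linarith
        have c3 : ¬ (n:ℝ) ≤ t := by linarith
        simp only [c1, c2, c3, if_false]
        have c4 : (t - s)/η ≤ 0 := by apply div_nonpos_of_nonpos_of_nonneg <;> linarith
        rw [hd0 _ c4, show T ((t-s)/η) = 0 from Real.smoothTransition.zero_of_nonpos c4]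
        simp
    calc _ ≤ _ := hL
      _ ≤ _ := hsp
      _ ≤ _ := by gcongr
  have hfin : ut - 0 ≤ r * ((G / η) ^ 2 * (us - ut) + G ^ 2 * 0)
      + Real.exp (c * (1 + r ^ (-(1:ℝ)/δ))) * us ^ 2 := by
    apply le_of_tendsto_of_tendsto (hlim.const_sub ut)
      ((((hlim.const_mul (G^2)).const_add _).const_mul r).add_const _)
    obtain ⟨n0, hn0⟩ := exists_nat_ge (s + η)
    filter_upwards [Filter.eventually_ge_atTop n0] with n hn
    exact key n (hn0.trans (by exact_mod_cast hn))
  linarith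

lemma tail_lim {μ : Measure (Eu d)} [IsProbabilityMeasure μ] {e : ℝ} (he : 0 < e) :
    ∃ s : ℝ, 1 ≤ s ∧ μ.real {x : Eu d | s ≤ rho x} ≤ e := by
  have hmeas : ∀ t : ℝ, MeasurableSet {x : Eu d | t ≤ rho x} := fun t =>
    (isClosed_le continuous_const rho_continuous).measurableSet
  have hlim := rho_tail_tendsto (μ := μ)
  obtain ⟨n, hn1, hn2⟩ := ((hlim.eventually_le_const he).and (Filter.eventually_ge_atTop 1)).exists
  exact ⟨n, by exact_mod_cast hn2, hn1⟩

set_option maxHeartbeats 1000000 in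
lemma conc {μ : Measure (Eu d)} [IsProbabilityMeasure μ] {c δ p : ℝ} (hc : 0 < c)
    (hδ : δ ∈ Ioo (1:ℝ) 2) (hp : p = 2 / (2 - δ)) (hSP : SP μ c δ) :
    ∃ A ≥ (1:ℝ), ∃ ε > (0:ℝ), ∀ s ≥ (0:ℝ), μ.real {x | s ≤ rho x} ≤ A * Real.exp (-ε * s ^ p) := by
  obtain ⟨hp2, hpδ⟩ := expo_facts hδ hp
  obtain ⟨hδ1, hδ2⟩ := hδ
  have hδ0 : δ ≠ 0 := by linarith
  obtain ⟨G, hG, hGb⟩ := smoothTransition_deriv_bdd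
  set q : ℝ := 1 - δ / 2 with hq
  have hqp : q * p = 1 := by rw [hq, hp]; have : 2 - δ ≠ 0 := by linarith
                             field_simp
  have hq0 : 0 < q := by rw [hq]; linarith
  have hq1 : q ≤ 1 := by rw [hq]; linarith
  set L : ℝ := G * (4 * c) ^ (δ / 2) / q with hL
  have hLpos : 0 < L := by positivity
  set K0 : ℝ := c + 1 / 4 + 1 with hK0
  obtain ⟨s0, hs01, hs0⟩ := tail_lim (μ := μ) (Real.exp_pos (-K0))
  have hmono : ∀ s t : ℝ, s ≤ t → μ.real {x : Eu d | t ≤ rho x} ≤ μ.real {x : Eu d | s ≤ rho x} :=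
    fun s t hst => measureReal_mono (fun x hx => le_trans hst hx)
  have hind : ∀ m : ℕ, μ.real {x : Eu d | s0 + L * (m:ℝ) ^ q ≤ rho x} ≤ Real.exp (-(m:ℝ) / 4 - K0) := by
    intro m
    induction m with
    | zero => simpa [Real.zero_rpow hq0.ne'] using hs0
    | succ m ih =>
      set s := s0 + L * (m:ℝ) ^ q with hs
      have hm1 : (0:ℝ) < (m:ℝ) + 1 := by positivity
      set η := L * (q * ((m:ℝ) + 1) ^ (q - 1)) with hη
      have hηpos : 0 < η := by positivity
      have hbern : (m:ℝ) ^ q + q * ((m:ℝ) + 1) ^ (q - 1) ≤ ((m:ℝ)+1) ^ q := by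
        have h1 := rpow_one_add_le_one_add_mul_self (s := -1 / ((m:ℝ)+1)) (by
          rw [le_div_iff₀ hm1]; have : (0:ℝ) ≤ m := by positivity
          linarith) hq0.le hq1
        have h2 : 1 + -1 / ((m:ℝ)+1) = m / ((m:ℝ)+1) := by field_simp; ring
        rw [h2, Real.div_rpow (by positivity) hm1.le, div_le_iff₀ (by positivity)] at h1
        rw [Real.rpow_sub_one hm1.ne']
        have h3 : (1 + q * (-1 / ((m:ℝ) + 1))) * ((m:ℝ) + 1) ^ q
          = ((m:ℝ) + 1) ^ q - q * (((m:ℝ) + 1) ^ q / ((m:ℝ) + 1)) := by field_simp; ring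
        linarith
      have hle : s + η ≤ s0 + L * ((m+1 : ℕ):ℝ) ^ q := by
        push_cast
        rw [hs, hη, add_assoc, ← mul_add]
        gcongr
      have hr : 0 < (η / G) ^ 2 := by positivity
      have hst := conc_step hSP hG hGb (s := s) hηpos hr
      have e1 : (η / G) ^ 2 * (G / η) ^ 2 = 1 := by field_simp
      have e2 : c * ((η / G) ^ 2) ^ (-(1:ℝ)/δ) = ((m:ℝ) + 1) / 4 := by
        have : η / G = (4 * c) ^ (δ/2) * ((m:ℝ) + 1) ^ (q - 1) := by
          rw [hη, hL]; field_simp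
        rw [this, ← Real.rpow_natCast, Real.mul_rpow (by positivity) (by positivity),
          Real.mul_rpow (by positivity) (by positivity), ← Real.rpow_mul (by positivity),
          ← Real.rpow_mul (by positivity), ← Real.rpow_mul (by positivity),
          ← Real.rpow_mul (by positivity)]
        push_cast
        rw [show δ / 2 * (2 * (-1 / δ)) = -1 by field_simp, show (q - 1) * (2 * (-1 / δ)) = 1 by
          rw [hq]; field_simp; ring, Real.rpow_neg_one, Real.rpow_one]
        field_simp
      rw [e1, mul_add, e2] at hst
      set us := μ.real {x : Eu d | s ≤ rho x} with hus
      set ut := μ.real {x : Eu d | s + η ≤ rho x} with hut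
      have hus0 : 0 ≤ us := measureReal_nonneg
      have hβ : Real.exp (c * 1 + ((m:ℝ)+1)/4) * us ≤ 1 / 2 := by
        calc _ ≤ Real.exp (c * 1 + ((m:ℝ)+1)/4) * Real.exp (-(m:ℝ) / 4 - K0) := by gcongr
          _ = Real.exp (-1) := by rw [← Real.exp_add, hK0]; congr 1; ring
          _ ≤ 1 / 2 := by
            rw [Real.exp_neg, inv_eq_one_div]
            apply one_div_le_one_div_of_le (by norm_num)
            linarith [Real.add_one_le_exp (1:ℝ)]
      have h34 : ut ≤ 3 / 4 * us := by
        have : Real.exp (c * 1 + ((m:ℝ)+1)/4) * us ^ 2 ≤ 1 / 2 * us := by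
          rw [pow_two, ← mul_assoc]; gcongr
        linarith
      have h35 : (3:ℝ) / 4 ≤ Real.exp (-1/4) := by linarith [Real.add_one_le_exp (-1/4:ℝ)]
      calc _ ≤ ut := hmono _ _ hle
        _ ≤ 3 / 4 * us := h34
        _ ≤ Real.exp (-1/4) * Real.exp (-(m:ℝ) / 4 - K0) := by gcongr
        _ = _ := by rw [← Real.exp_add]; push_cast; congr 1; ring
  set ε : ℝ := (1 / (2 * L)) ^ p / 4 with hε
  have hεpos : 0 < ε := by positivity
  refine ⟨Real.exp (1 / 4 + ε * (2 * s0) ^ p), ?_, ε, hεpos, ?_⟩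
  · apply Real.one_le_exp; positivity
  intro s hs
  rw [← Real.exp_add]
  by_cases hcase : s ≤ 2 * s0
  · calc _ ≤ (1:ℝ) := measureReal_le_one
      _ ≤ _ := by
        apply Real.one_le_exp
        have : s ^ p ≤ (2 * s0) ^ p := Real.rpow_le_rpow hs hcase (by linarith)
        nlinarith
  · push Not at hcase
    set y := (s / (2 * L)) ^ p with hy
    have hy0 : 0 ≤ y := by positivity
    set m := ⌊y⌋₊ with hm
    have hmy : (m:ℝ) ≤ y := Nat.floor_le hy0
    have hmy2 : y < m + 1 := Nat.lt_floor_add_one y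
    have hle : s0 + L * (m:ℝ) ^ q ≤ s := by
      have : (m:ℝ) ^ q ≤ s / (2 * L) := by
        calc (m:ℝ) ^ q ≤ y ^ q := Real.rpow_le_rpow (by positivity) hmy hq0.le
          _ = s / (2 * L) := by rw [hy, ← Real.rpow_mul (by positivity), mul_comm p q, hqp, Real.rpow_one]
      have h2 : L * (m:ℝ) ^ q ≤ L * (s / (2 * L)) := by gcongr
      have h3 : L * (s / (2 * L)) = s / 2 := by field_simp
      linarith
    have hεy : ε * s ^ p = y / 4 := by
      rw [hε, hy, div_eq_mul_one_div s, Real.mul_rpow hs (by positivity)]; ring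
    calc _ ≤ _ := hmono _ _ hle
      _ ≤ _ := hind m
      _ ≤ _ := by
        apply Real.exp_le_exp.2
        rw [neg_mul, hεy]
        have : 0 ≤ ε * (2 * s0) ^ p := by positivity
        linarith

end conc

section localP
variable {d : ℕ}
open scoped ENNReal

lemma sq_diff_le {f : Eu d → ℝ} (hf : ContDiff ℝ (⊤ : ℕ∞) f) (x y : Eu d) :
    (f y - f x) ^ 2 ≤ ‖y - x‖ ^ 2 * ∫ t in (0:ℝ)..1, ‖fderiv ℝ f (x + t • (y - x))‖ ^ 2 := by
  have hcont : Continuous (fun t : ℝ => x + t • (y - x)) := by fun_prop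
  have hfd : Continuous (fderiv ℝ f) := hf.continuous_fderiv (by simp)
  have hc1 : Continuous (fun t : ℝ => fderiv ℝ f (x + t • (y - x)) (y - x)) :=
    (hfd.comp hcont).clm_apply continuous_const
  have hc2 : Continuous (fun t : ℝ => ‖fderiv ℝ f (x + t • (y - x))‖) := (hfd.comp hcont).norm
  have hder : ∀ t : ℝ, HasDerivAt (fun t : ℝ => f (x + t • (y - x)))
      (fderiv ℝ f (x + t • (y - x)) (y - x)) t := by
    intro t
    have h1 : HasFDerivAt f (fderiv ℝ f (x + t • (y - x))) (x + t • (y - x)) :=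
      (hf.differentiable (by simp) _).hasFDerivAt
    have h2 : HasDerivAt (fun t : ℝ => x + t • (y - x)) (y - x) t := by
      simpa using ((hasDerivAt_id t).smul_const (y - x)).const_add x
    exact h1.comp_hasDerivAt t h2
  have hFTC : ∫ t in (0:ℝ)..1, fderiv ℝ f (x + t • (y - x)) (y - x) = f y - f x := by
    rw [intervalIntegral.integral_eq_sub_of_hasDerivAt (fun t _ => hder t) (hc1.intervalIntegrable _ _)]
    simp
  set I := ∫ t in (0:ℝ)..1, ‖fderiv ℝ f (x + t • (y - x))‖ with hI
  have h1 : |f y - f x| ≤ ‖y - x‖ * I := by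
    rw [← hFTC, hI, ← intervalIntegral.integral_const_mul]
    have := intervalIntegral.norm_integral_le_of_norm_le (μ := volume) (a := (0:ℝ)) (b := 1)
      (f := fun t => fderiv ℝ f (x + t • (y - x)) (y - x))
      (g := fun t => ‖y - x‖ * ‖fderiv ℝ f (x + t • (y - x))‖) zero_le_one
      (Filter.Eventually.of_forall (fun t _ => by
        rw [mul_comm]; exact ContinuousLinearMap.le_opNorm _ _))
      ((continuous_const.mul hc2).intervalIntegrable _ _)
    exact this
  have h2 : I ^ 2 ≤ ∫ t in (0:ℝ)..1, ‖fderiv ℝ f (x + t • (y - x))‖ ^ 2 := by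
    have h3 : 0 ≤ ∫ t in (0:ℝ)..1, (‖fderiv ℝ f (x + t • (y - x))‖ - I) ^ 2 :=
      intervalIntegral.integral_nonneg zero_le_one (fun t _ => sq_nonneg _)
    have h4 : ∫ t in (0:ℝ)..1, (‖fderiv ℝ f (x + t • (y - x))‖ - I) ^ 2
        = (∫ t in (0:ℝ)..1, ‖fderiv ℝ f (x + t • (y - x))‖ ^ 2) - I ^ 2 := by
      have : ∀ t : ℝ, (‖fderiv ℝ f (x + t • (y - x))‖ - I) ^ 2
        = ‖fderiv ℝ f (x + t • (y - x))‖ ^ 2 + ((-2 * I) * ‖fderiv ℝ f (x + t • (y - x))‖ + I ^ 2) := by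
        intro t; ring
      simp only [this]
      have i1 : IntervalIntegrable (fun t : ℝ => ‖fderiv ℝ f (x + t • (y - x))‖ ^ 2) volume 0 1 :=
        (hc2.pow 2).intervalIntegrable _ _
      have i2 : IntervalIntegrable (fun t : ℝ => (-2 * I) * ‖fderiv ℝ f (x + t • (y - x))‖) volume 0 1 :=
        (continuous_const.mul hc2).intervalIntegrable _ _
      have i3 : IntervalIntegrable (fun t : ℝ => I ^ 2) volume 0 1 := continuous_const.intervalIntegrable _ _
      rw [intervalIntegral.integral_add i1 (i2.add i3), intervalIntegral.integral_add i2 i3,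
        intervalIntegral.integral_const_mul, ← hI]
      simp; ring
    linarith
  have hI0 : 0 ≤ I := intervalIntegral.integral_nonneg zero_le_one (fun t _ => norm_nonneg _)
  calc (f y - f x) ^ 2 = |f y - f x| ^ 2 := (sq_abs _).symm
    _ ≤ (‖y - x‖ * I) ^ 2 := by gcongr
    _ = ‖y - x‖ ^ 2 * I ^ 2 := by ring
    _ ≤ _ := by gcongr

lemma lint_scale (F : Eu d → ℝ≥0∞) (hF : Measurable F) (v : Eu d) {t : ℝ} (ht : 1 / 2 ≤ t) :
    ∫⁻ y, F (v + t • y) ≤ 2 ^ d * ∫⁻ y, F y := by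
  have ht0 : t ≠ 0 := by linarith
  have h1 : ∫⁻ y, F (v + t • y) = ∫⁻ z, F (v + z) ∂(Measure.map (fun y : Eu d => t • y) volume) := by
    have hm : Measurable (fun z => F (v + z)) := hF.comp (measurable_const_add v)
    rw [lintegral_map hm (measurable_const_smul t)]
  rw [h1, Measure.map_addHaar_smul _ ht0, lintegral_smul_measure, lintegral_add_left_eq_self]
  simp only [finrank_euclideanSpace, Fintype.card_fin, smul_eq_mul]
  gcongr
  rw [show (2:ℝ≥0∞) ^ d = ENNReal.ofReal (2 ^ d) by rw [ENNReal.ofReal_pow (by norm_num)]; simp]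
  apply ENNReal.ofReal_le_ofReal
  rw [abs_of_pos (by positivity), ← inv_pow]
  apply pow_le_pow_left₀ (by positivity)
  rw [inv_le_comm₀ (by linarith) (by norm_num)]
  linarith

lemma leb_poincare {S : ℝ} (hS : 0 < S) : ∃ C : ℝ≥0∞, C ≠ ∞ ∧ ∀ f : Eu d → ℝ, ContDiff ℝ (⊤ : ℕ∞) f →
    ∃ m : ℝ, ∫⁻ x in Metric.closedBall (0 : Eu d) S, ENNReal.ofReal ((f x - m) ^ 2) ≤
      C * ∫⁻ x in Metric.closedBall (0 : Eu d) S, ENNReal.ofReal (‖fderiv ℝ f x‖ ^ 2) := by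
  set B := Metric.closedBall (0 : Eu d) S with hB
  have hBm : MeasurableSet B := Metric.isClosed_closedBall.measurableSet
  have hBt : volume B ≠ ∞ := (isCompact_closedBall _ _).measure_lt_top.ne
  have hB0 : volume B ≠ 0 := (Metric.measure_closedBall_pos volume _ hS).ne'
  have hconv : Convex ℝ B := convex_closedBall _ _
  refine ⟨ENNReal.ofReal ((2 * S) ^ 2) * 2 ^ d, by finiteness, ?_⟩
  intro f hf
  have hfd : Continuous (fderiv ℝ f) := hf.continuous_fderiv (by simp)
  set g : Eu d → ℝ≥0∞ := fun x => ENNReal.ofReal (‖fderiv ℝ f x‖ ^ 2) with hg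
  have hgc : Continuous g := ENNReal.continuous_ofReal.comp (hfd.norm.pow 2)
  set F : Eu d → ℝ≥0∞ := B.indicator g with hF
  have hFm : Measurable F := hgc.measurable.indicator hBm
  set J : ℝ≥0∞ := ∫⁻ x in B, g x with hJ
  have hFJ : ∫⁻ x, F x = J := lintegral_indicator hBm g
  -- pointwise bound
  have hpt : ∀ x ∈ B, ∀ y ∈ B, ENNReal.ofReal ((f y - f x) ^ 2) ≤
      ENNReal.ofReal ((2 * S) ^ 2) * ∫⁻ t in Ioc (0:ℝ) 1, F (x + t • (y - x)) := by
    intro x hx y hy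
    have h1 := sq_diff_le hf x y
    have hcont : Continuous (fun t : ℝ => ‖fderiv ℝ f (x + t • (y - x))‖ ^ 2) :=
      ((hfd.comp (by fun_prop : Continuous (fun t : ℝ => x + t • (y - x)))).norm.pow 2)
    have h2 : ENNReal.ofReal (∫ t in (0:ℝ)..1, ‖fderiv ℝ f (x + t • (y - x))‖ ^ 2)
        = ∫⁻ t in Ioc (0:ℝ) 1, F (x + t • (y - x)) := by
      rw [intervalIntegral.integral_of_le zero_le_one, ofReal_integral_eq_lintegral_ofReal]
      · apply setLIntegral_congr_fun measurableSet_Ioc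
        intro t ht
        have hmem : x + t • (y - x) ∈ B := hconv.add_smul_sub_mem hx hy ⟨ht.1.le, ht.2⟩
        simp only [hF, Set.indicator_of_mem hmem, hg]
      · exact (hcont.intervalIntegrable 0 1).1
      · exact Filter.Eventually.of_forall (fun t => by simp only [Pi.zero_apply]; positivity)
    have h3 : ‖y - x‖ ^ 2 ≤ (2 * S) ^ 2 := by
      have e1 : ‖x‖ ≤ S := by simpa [hB] using hx
      have e2 : ‖y‖ ≤ S := by simpa [hB] using hy
      have := norm_sub_le y x
      gcongr
      linarith
    have h4 : 0 ≤ ∫ t in (0:ℝ)..1, ‖fderiv ℝ f (x + t • (y - x))‖ ^ 2 :=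
      intervalIntegral.integral_nonneg zero_le_one (fun t _ => by positivity)
    rw [← h2, ← ENNReal.ofReal_mul (by positivity)]
    apply ENNReal.ofReal_le_ofReal
    exact h1.trans (by gcongr)
  -- for each t
  have hmeas3 : Measurable (fun q : (Eu d × Eu d) × ℝ => F (q.1.1 + q.2 • (q.1.2 - q.1.1))) := by
    apply hFm.comp
    fun_prop
  have ht : ∀ t ∈ Ioc (0:ℝ) 1, ∫⁻ x in B, ∫⁻ y in B, F (x + t • (y - x)) ≤ 2 ^ d * J * volume B := by
    intro t ht
    by_cases hh : 1 / 2 ≤ t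
    · calc ∫⁻ x in B, ∫⁻ y in B, F (x + t • (y - x)) ≤ ∫⁻ x in B, 2 ^ d * J := by
            apply lintegral_mono
            intro x
            calc ∫⁻ y in B, F (x + t • (y - x)) ≤ ∫⁻ y, F (x + t • (y - x)) := setLIntegral_le_lintegral _ _
              _ = ∫⁻ y, F ((x - t • x) + t • y) := by
                congr 1; ext y; congr 1; rw [smul_sub]; abel
              _ ≤ 2 ^ d * ∫⁻ y, F y := lint_scale F hFm _ hh
              _ = _ := by rw [hFJ]
        _ = _ := by rw [setLIntegral_const]
    · rw [lintegral_lintegral_swap]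
      · calc ∫⁻ y in B, ∫⁻ x in B, F (x + t • (y - x)) ≤ ∫⁻ x in B, 2 ^ d * J := by
              apply lintegral_mono
              intro y
              calc ∫⁻ x in B, F (x + t • (y - x)) ≤ ∫⁻ x, F (x + t • (y - x)) := setLIntegral_le_lintegral _ _
                _ = ∫⁻ x, F ((t • y) + (1 - t) • x) := by
                  congr 1; ext x; congr 1; rw [smul_sub, sub_smul, one_smul]; abel
                _ ≤ 2 ^ d * ∫⁻ y, F y := lint_scale F hFm _ (by linarith)
                _ = _ := by rw [hFJ]
          _ = _ := by rw [setLIntegral_const]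
      · apply Measurable.aemeasurable
        apply hFm.comp
        fun_prop
  have htot : ∫⁻ x in B, ∫⁻ y in B, ENNReal.ofReal ((f y - f x) ^ 2) ≤
      ENNReal.ofReal ((2 * S) ^ 2) * (2 ^ d * J * volume B) := by
    calc ∫⁻ x in B, ∫⁻ y in B, ENNReal.ofReal ((f y - f x) ^ 2)
        ≤ ∫⁻ x in B, ∫⁻ y in B, ENNReal.ofReal ((2 * S) ^ 2) * ∫⁻ t in Ioc (0:ℝ) 1, F (x + t • (y - x)) := by
          apply setLIntegral_mono' hBm
          intro x hx
          apply setLIntegral_mono' hBm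
          intro y hy
          exact hpt x hx y hy
      _ = ENNReal.ofReal ((2 * S) ^ 2) * ∫⁻ x in B, ∫⁻ y in B, ∫⁻ t in Ioc (0:ℝ) 1, F (x + t • (y - x)) := by
          rw [← lintegral_const_mul' _ _ (by finiteness)]
          congr 1; ext x
          rw [lintegral_const_mul' _ _ (by finiteness)]
      _ = ENNReal.ofReal ((2 * S) ^ 2) * ∫⁻ t in Ioc (0:ℝ) 1, ∫⁻ x in B, ∫⁻ y in B, F (x + t • (y - x)) := by
          congr 1
          have e1 : ∀ G : Eu d → Eu d → ℝ≥0∞, Measurable (Function.uncurry G) →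
            ∫⁻ x in B, ∫⁻ y in B, G x y = ∫⁻ q, G q.1 q.2 ∂((volume.restrict B).prod (volume.restrict B)) := by
            intro G hG
            exact (lintegral_prod (fun q : Eu d × Eu d => G q.1 q.2) (hG.aemeasurable)).symm
          rw [e1 (fun x y => ∫⁻ t in Ioc (0:ℝ) 1, F (x + t • (y - x)))
            (Measurable.lintegral_prod_right' (f := fun q : (Eu d × Eu d) × ℝ => F (q.1.1 + q.2 • (q.1.2 - q.1.1))) hmeas3)]
          rw [lintegral_lintegral_swap hmeas3.aemeasurable]
          congr 1; ext t
          rw [e1 (fun x y => F (x + t • (y - x)))]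
          apply hFm.comp
          fun_prop
      _ ≤ ENNReal.ofReal ((2 * S) ^ 2) * ∫⁻ t in Ioc (0:ℝ) 1, 2 ^ d * J * volume B := by
          gcongr 1
          exact setLIntegral_mono' measurableSet_Ioc ht
      _ = _ := by rw [setLIntegral_const]; simp
  have hmeasJ : Measurable (fun x => ∫⁻ y in B, ENNReal.ofReal ((f y - f x) ^ 2)) := by
    apply Measurable.lintegral_prod_right' (f := fun q : Eu d × Eu d => ENNReal.ofReal ((f q.2 - f q.1) ^ 2))
    have := hf.continuous
    fun_prop
  obtain ⟨y, hy, hyle⟩ := exists_le_setLAverage hB0 hBt hmeasJ.aemeasurable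
  refine ⟨f y, hyle.trans ?_⟩
  rw [setLAverage_eq]
  apply ENNReal.div_le_of_le_mul
  refine htot.trans (le_of_eq ?_)
  ring

lemma local_poincare {V : Eu d → ℝ} (hV : Continuous V) {μ : Measure (Eu d)} [IsFiniteMeasure μ]
    (hμ : μ = volume.withDensity (fun x => ENNReal.ofReal (Real.exp (V x)))) {S : ℝ} (hS : 0 < S) :
    ∃ C > (0:ℝ), ∀ f : Eu d → ℝ, ContDiff ℝ (⊤ : ℕ∞) f →
    ∃ m : ℝ, ∫ x in Metric.closedBall (0 : Eu d) S, (f x - m) ^ 2 ∂μ ≤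
      C * ∫ x in Metric.closedBall (0 : Eu d) S, ‖fderiv ℝ f x‖ ^ 2 ∂μ := by
  obtain ⟨C, hC, hP⟩ := leb_poincare (d := d) hS
  set B := Metric.closedBall (0 : Eu d) S with hB
  have hBm : MeasurableSet B := Metric.isClosed_closedBall.measurableSet
  obtain ⟨M, hM⟩ := (isCompact_closedBall (0 : Eu d) S).exists_bound_of_continuousOn hV.continuousOn
  have hub : ∀ x ∈ B, Real.exp (V x) ≤ Real.exp M := fun x hx =>
    Real.exp_le_exp.2 ((le_abs_self _).trans (hM x hx))
  have hlb : ∀ x ∈ B, Real.exp (-M) ≤ Real.exp (V x) := fun x hx =>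
    Real.exp_le_exp.2 (by have := (abs_le.1 (hM x hx)).1; linarith)
  have hVm : Measurable (fun x => ENNReal.ofReal (Real.exp (V x))) := by
    have := hV.measurable
    fun_prop
  set K : ℝ≥0∞ := ENNReal.ofReal (Real.exp M) * C * ENNReal.ofReal (Real.exp M) with hK
  have hKt : K ≠ ∞ := by rw [hK]; finiteness
  refine ⟨K.toReal + 1, by positivity, ?_⟩
  intro f hf
  obtain ⟨m, hm⟩ := hP f hf
  refine ⟨m, ?_⟩
  have hfd : Continuous (fderiv ℝ f) := hf.continuous_fderiv (by simp)
  have hc1 : Continuous (fun x => (f x - m) ^ 2) := (hf.continuous.sub continuous_const).pow 2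
  have hc2 : Continuous (fun x => ‖fderiv ℝ f x‖ ^ 2) := hfd.norm.pow 2
  have hi2 : IntegrableOn (fun x => ‖fderiv ℝ f x‖ ^ 2) B μ :=
    hc2.continuousOn.integrableOn_compact (isCompact_closedBall _ _)
  have hwd : ∀ φ : Eu d → ℝ, Continuous φ → ∫⁻ x in B, ENNReal.ofReal (φ x) ∂μ
      = ∫⁻ x in B, ENNReal.ofReal (Real.exp (V x)) * ENNReal.ofReal (φ x) := by
    intro φ hφ
    rw [hμ, setLIntegral_withDensity_eq_setLIntegral_mul _ hVm (by
      have := hφ.measurable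
      fun_prop) hBm]
    rfl
  have key : ∫⁻ x in B, ENNReal.ofReal ((f x - m) ^ 2) ∂μ ≤
      K * ∫⁻ x in B, ENNReal.ofReal (‖fderiv ℝ f x‖ ^ 2) ∂μ := by
    rw [hwd _ hc1, hwd _ hc2]
    calc _ ≤ ∫⁻ x in B, ENNReal.ofReal (Real.exp M) * ENNReal.ofReal ((f x - m) ^ 2) := by
          apply setLIntegral_mono' hBm
          intro x hx
          gcongr
          exact Real.exp_le_exp.1 (hub x hx)
      _ = ENNReal.ofReal (Real.exp M) * ∫⁻ x in B, ENNReal.ofReal ((f x - m) ^ 2) :=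
          lintegral_const_mul' _ _ (by finiteness)
      _ ≤ ENNReal.ofReal (Real.exp M) * (C * ∫⁻ x in B, ENNReal.ofReal (‖fderiv ℝ f x‖ ^ 2)) := by gcongr
      _ ≤ ENNReal.ofReal (Real.exp M) * (C * (ENNReal.ofReal (Real.exp M) *
            ∫⁻ x in B, ENNReal.ofReal (Real.exp (V x)) * ENNReal.ofReal (‖fderiv ℝ f x‖ ^ 2))) := by
          gcongr
          rw [← lintegral_const_mul' _ _ (by finiteness)]
          apply setLIntegral_mono' hBm
          intro x hx
          rw [← mul_assoc, ← ENNReal.ofReal_mul (by positivity)]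
          have : (1:ℝ) ≤ Real.exp M * Real.exp (V x) := by
            calc (1:ℝ) = Real.exp M * Real.exp (-M) := by rw [← Real.exp_add]; simp
              _ ≤ _ := by gcongr; exact (Real.exp_le_exp.1 (hlb x hx))
          calc ENNReal.ofReal (‖fderiv ℝ f x‖ ^ 2) = 1 * ENNReal.ofReal (‖fderiv ℝ f x‖ ^ 2) := (one_mul _).symm
            _ ≤ _ := by
              gcongr
              exact ENNReal.one_le_ofReal.2 this
      _ = _ := by rw [hK]; ring
  have hfin : ∫⁻ x in B, ENNReal.ofReal (‖fderiv ℝ f x‖ ^ 2) ∂μ ≠ ∞ := by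
    rw [← ofReal_integral_eq_lintegral_ofReal hi2 (Filter.Eventually.of_forall (fun t => by
      simp only [Pi.zero_apply]; positivity))]
    exact ENNReal.ofReal_ne_top
  rw [integral_eq_lintegral_of_nonneg_ae (Filter.Eventually.of_forall (fun t => by
      simp only [Pi.zero_apply]; positivity)) hc1.aestronglyMeasurable,
    integral_eq_lintegral_of_nonneg_ae (Filter.Eventually.of_forall (fun t => by
      simp only [Pi.zero_apply]; positivity)) hc2.aestronglyMeasurable]
  have := ENNReal.toReal_mono (by finiteness) key
  rw [ENNReal.toReal_mul] at this
  refine this.trans ?_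
  gcongr
  linarith

end localP

section hardy
variable {d : ℕ}

lemma le_of_sq_le_sq_pos {a b : ℝ} (h : a ^ 2 ≤ b ^ 2) (hb : 0 ≤ b) : a ≤ b :=
  le_of_abs_le (abs_le_of_sq_le_sq h hb)

lemma chi_contDiff {θ : ℝ → ℝ} (hθ : ContDiff ℝ (⊤ : ℕ∞) θ) (a : ℝ) :
    ContDiff ℝ (⊤ : ℕ∞) (fun y : Eu d => θ (rho y ^ 2 / a)) :=
  hθ.comp ((rho_contDiff.pow 2).div_const a)

lemma chi_fd {θ : ℝ → ℝ} (hθ : ContDiff ℝ (⊤ : ℕ∞) θ) {a : ℝ} (ha : 0 < a) (x : Eu d) :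
    ‖fderiv ℝ (fun y : Eu d => θ (rho y ^ 2 / a)) x‖ ≤ |deriv θ (rho x ^ 2 / a)| * (2 * rho x / a) := by
  have hu : ContDiff ℝ (⊤ : ℕ∞) (fun y : Eu d => rho y ^ 2) := rho_contDiff.pow 2
  have hu' : ContDiff ℝ (⊤ : ℕ∞) (fun y : Eu d => rho y ^ 2 / a) := hu.div_const a
  have h0 := norm_fderiv_comp (θ := θ) (u := fun y : Eu d => rho y ^ 2 / a)
    hθ hu' x
  rw [h0]
  gcongr
  have h1 : fderiv ℝ (fun y : Eu d => rho y ^ 2 / a) x = a⁻¹ • fderiv ℝ (fun y : Eu d => rho y ^ 2) x := by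
    rw [← fderiv_const_smul (hu.differentiable (by simp) x)]
    congr 1; ext y; simp [div_eq_inv_mul]
  rw [h1, norm_smul, Real.norm_of_nonneg (by positivity), div_eq_inv_mul]
  gcongr
  exact fderiv_rho_sq x

lemma rho_sq_bdd_compact {χ : Eu d → ℝ} {M : ℝ} (hM : 0 ≤ M) (h : ∀ x, M ^ 2 < rho x ^ 2 → χ x = 0) :
    HasCompactSupport χ := by
  apply HasCompactSupport.of_support_subset_isCompact (isCompact_closedBall (0 : Eu d) M)
  intro x hx
  rw [mem_closedBall_zero_iff]
  by_contra hc
  push Not at hc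
  apply hx
  apply h
  have := norm_le_rho x
  have := rho_pos x
  nlinarith

set_option maxHeartbeats 1000000 in
lemma hardy {μ : Measure (Eu d)} [IsProbabilityMeasure μ] {c δ p : ℝ} (hc : 0 < c)
    (hδ : δ ∈ Ioo (1:ℝ) 2) (hp : p = 2 / (2 - δ)) (hSP : SP μ c δ) :
    ∃ C > (0:ℝ), ∀ g : Eu d → ℝ, ContDiff ℝ (⊤ : ℕ∞) g → Integrable (Fn p g) μ → ∀ N : ℕ,
      ∫ x in {x : Eu d | rho x ^ 2 < (4:ℝ)^N}, rho x ^ p * g x ^ 2 ∂μ ≤ C * ∫ x, Fn p g x ∂μ := by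
  obtain ⟨hp2, -⟩ := expo_facts hδ hp
  obtain ⟨A, hA, ε, hε, hconc⟩ := conc hc hδ hp hSP
  obtain ⟨θ, hθ, hθ0, hθ1, hθe, hθz, hθd, G, hG, hθG⟩ := exists_bump (5/2) (3/2) 2 (by norm_num) (by norm_num)
  have hε' : 0 < ε * (1/2:ℝ)^p := by positivity
  obtain ⟨C, hC, hcore⟩ := core hc hδ hp hSP hA hε' (G := 6 * G) (by positivity)
  refine ⟨(2:ℝ)^p * (C * 2), by positivity, ?_⟩
  intro g hg hFint N
  have hzero : ∀ (n : ℕ) (x : Eu d), rho x ^ 2 ∉ Icc ((4:ℝ)^n/2) (9/2*4^n) →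
      2 ≤ |rho x ^ 2 / 4 ^ n - 5/2| := by
    intro n x hx
    have h4 : (0:ℝ) < 4 ^ n := by positivity
    rw [mem_Icc, not_and_or, not_le, not_le] at hx
    rw [le_abs]
    rcases hx with hx | hx
    · right
      have : rho x ^ 2 / 4 ^ n < 1 / 2 := by rw [div_lt_iff₀ h4]; linarith
      linarith
    · left
      have : 9 / 2 < rho x ^ 2 / 4 ^ n := by rw [lt_div_iff₀ h4]; linarith
      linarith
  have hsq : ∀ n : ℕ, (4:ℝ)^n = (2 ^ n) ^ 2 := by
    intro n; rw [← pow_mul, mul_comm, pow_mul]; norm_num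
  have hstep : ∀ n : ℕ, ((2:ℝ)^n)^p * ∫ x, (θ (rho x ^ 2 / 4 ^ n) * g x) ^ 2 ∂μ ≤
      C * ∫ x in {x : Eu d | rho x ^ 2 ∈ Icc ((4:ℝ)^n/2) (9/2*4^n)}, Fn p g x ∂μ := by
    intro n
    have hR : (1:ℝ) ≤ 2 ^ n := one_le_pow₀ (by norm_num)
    have h4 : (0:ℝ) < 4 ^ n := by positivity
    have hS4 : ∀ x : Eu d, rho x ^ 2 ∈ Icc ((4:ℝ)^n/2) (9/2*4^n) → rho x ≤ 3 * 2 ^ n := by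
      intro x hx
      have h1 := hx.2
      rw [hsq] at h1
      refine le_of_sq_le_sq_pos ?_ (by positivity)
      nlinarith
    apply hcore (2^n) hR (fun x => θ (rho x ^ 2 / 4 ^ n)) g _ (chi_contDiff hθ _) hg
    · exact measurableSet_Icc.preimage (rho_continuous.pow 2).measurable
    · intro x; rw [abs_of_nonneg (hθ0 _)]; exact hθ1 _
    · intro x hx
      exact hθz _ (hzero n x hx)
    · intro x hx
      rw [← norm_le_zero_iff]
      refine (chi_fd hθ h4 x).trans ?_
      rw [hθd _ (hzero n x hx)]; simp
    · intro x
      refine (chi_fd hθ h4 x).trans ?_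
      by_cases hx : rho x ^ 2 ∈ Icc ((4:ℝ)^n/2) (9/2*4^n)
      · calc _ ≤ G * (2 * (3 * 2 ^ n) / 4 ^ n) := by
              have := rho_pos x
              gcongr
              · exact hθG _
              · exact hS4 x hx
          _ = _ := by rw [hsq]; field_simp; norm_num
      · rw [hθd _ (hzero n x hx)]; simp; positivity
    · intro x hx
      have := hS4 x hx
      linarith
    · have hsub : {x : Eu d | θ (rho x ^ 2 / 4 ^ n) * g x ≠ 0} ⊆ {x | 2 ^ n / 2 ≤ rho x} := by
        intro x hx
        by_contra hc'
        simp only [mem_ofPred_eq, not_le] at hc'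
        apply hx
        rw [hθz, zero_mul]
        apply hzero
        intro hI
        have h1 := hI.1
        rw [hsq] at h1
        have := rho_pos x
        nlinarith
      refine (measureReal_mono hsub).trans ((hconc _ (by positivity)).trans (le_of_eq ?_))
      rw [div_eq_mul_one_div, Real.mul_rpow (by positivity) (by norm_num)]
      congr 2; ring
  have hii : ∀ n : ℕ, Integrable (fun x => (θ (rho x ^ 2 / 4 ^ n) * g x) ^ 2) μ := by
    intro n
    apply int_sq ((chi_contDiff hθ _).continuous.mul hg.continuous)
    apply rho_sq_bdd_compact (M := 3 * 2 ^ n) (by positivity)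
    intro x hx
    show θ (rho x ^ 2 / 4 ^ n) * g x = 0
    rw [hθz, zero_mul]
    apply hzero
    intro hI
    have h1 := hI.2
    rw [hsq] at h1
    have : (0:ℝ) < 2 ^ n := by positivity
    nlinarith
  have hpt : ∀ x : Eu d, rho x ^ 2 < (4:ℝ)^N → rho x ^ p * g x ^ 2 ≤
      ∑ n ∈ Finset.range N, 2 ^ p * (((2:ℝ)^n)^p * (θ (rho x ^ 2 / 4 ^ n) * g x) ^ 2) := by
    intro x hx
    have h1 : 1 ≤ rho x ^ 2 := one_le_pow₀ (one_le_rho x)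
    obtain ⟨n, hn1, hn2⟩ := exists_nat_pow_near h1 (show (1:ℝ) < 4 by norm_num)
    have hnN : n < N := by
      by_contra hcon
      push Not at hcon
      have : (4:ℝ)^N ≤ 4^n := pow_le_pow_right₀ (by norm_num) hcon
      linarith
    have h4 : (0:ℝ) < 4 ^ n := by positivity
    refine le_trans ?_ (Finset.single_le_sum (f := fun n => 2 ^ p * (((2:ℝ)^n)^p * (θ (rho x ^ 2 / 4 ^ n) * g x) ^ 2))
      (fun i _ => by positivity) (Finset.mem_range.2 hnN))
    have hone : θ (rho x ^ 2 / 4 ^ n) = 1 := by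
      apply hθe
      have a1 : 1 ≤ rho x ^ 2 / 4 ^ n := by rw [le_div_iff₀ h4]; linarith
      have a2 : rho x ^ 2 / 4 ^ n ≤ 4 := by
        rw [div_le_iff₀ h4]
        rw [pow_succ (4:ℝ) n] at hn2
        linarith
      rw [abs_le]; constructor <;> linarith
    simp only [hone, one_mul]
    rw [← mul_assoc, ← Real.mul_rpow (by norm_num) (by positivity)]
    have hr := rho_pos x
    gcongr
    refine le_of_sq_le_sq_pos ?_ (by positivity)
    rw [mul_pow, ← hsq]
    rw [pow_succ (4:ℝ) n] at hn2
    linarith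
  have hms : MeasurableSet {x : Eu d | rho x ^ 2 < (4:ℝ)^N} :=
    measurableSet_Iio.preimage (rho_continuous.pow 2).measurable
  have hsi : ∀ n ∈ Finset.range N, Integrable (fun x => 2 ^ p * (((2:ℝ)^n)^p * (θ (rho x ^ 2 / 4 ^ n) * g x) ^ 2)) μ :=
    fun n _ => ((hii n).const_mul _).const_mul _
  calc _ ≤ ∫ x in {x : Eu d | rho x ^ 2 < (4:ℝ)^N},
        ∑ n ∈ Finset.range N, 2 ^ p * (((2:ℝ)^n)^p * (θ (rho x ^ 2 / 4 ^ n) * g x) ^ 2) ∂μ := by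
        apply integral_mono_of_nonneg
        · exact Filter.Eventually.of_forall (fun x => by
            have := rho_pos x
            simp only [Pi.zero_apply]
            positivity)
        · exact (integrable_finsetSum _ hsi).integrableOn
        · exact (ae_restrict_iff' hms).2 (Filter.Eventually.of_forall hpt)
    _ ≤ ∫ x, ∑ n ∈ Finset.range N, 2 ^ p * (((2:ℝ)^n)^p * (θ (rho x ^ 2 / 4 ^ n) * g x) ^ 2) ∂μ := by
        apply setIntegral_le_integral (integrable_finsetSum _ hsi)
        exact Filter.Eventually.of_forall (fun x => by
            simp only [Pi.zero_apply]
            positivity)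
    _ = ∑ n ∈ Finset.range N, 2 ^ p * (((2:ℝ)^n)^p * ∫ x, (θ (rho x ^ 2 / 4 ^ n) * g x) ^ 2 ∂μ) := by
        rw [integral_finsetSum _ hsi]
        apply Finset.sum_congr rfl
        intro n _
        rw [integral_const_mul, integral_const_mul]
    _ ≤ ∑ n ∈ Finset.range N, 2 ^ p * (C * ∫ x in {x : Eu d | rho x ^ 2 ∈ Icc ((4:ℝ)^n/2) (9/2*4^n)}, Fn p g x ∂μ) := by
        apply Finset.sum_le_sum
        intro n _
        exact mul_le_mul_of_nonneg_left (hstep n) (by positivity)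
    _ = 2 ^ p * (C * ∑ n ∈ Finset.range N, ∫ x in {x : Eu d | rho x ^ 2 ∈ Icc ((4:ℝ)^n/2) (9/2*4^n)}, Fn p g x ∂μ) := by
        rw [Finset.mul_sum, Finset.mul_sum]
    _ ≤ 2 ^ p * (C * (2 * ∫ x, Fn p g x ∂μ)) := by
        gcongr
        exact sum_overlap (u := fun x => rho x ^ 2) (Fn_nonneg p g) hFint (rho_continuous.pow 2) N
    _ = _ := by ring
end hardy

section level
variable {d : ℕ}

lemma Fn_sq_integrable {μ : Measure (Eu d)} {p : ℝ} {g : Eu d → ℝ}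
    (hg : ContDiff ℝ (⊤ : ℕ∞) g) (hi : Integrable (Fn p g) μ) : Integrable (fun x => g x ^ 2) μ := by
  apply hi.mono' (hg.continuous.pow 2).aestronglyMeasurable
  refine Filter.Eventually.of_forall (fun x => ?_)
  show ‖g x ^ 2‖ ≤ _
  rw [Real.norm_of_nonneg (by positivity)]
  unfold Fn
  have := rho_pos x
  have : 0 ≤ rho x ^ (-(p-2)) * ‖fderiv ℝ g x‖ ^ 2 := by positivity
  linarith

lemma hardy_tail {μ : Measure (Eu d)} [IsProbabilityMeasure μ] {c δ p : ℝ} (hc : 0 < c)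
    (hδ : δ ∈ Ioo (1:ℝ) 2) (hp : p = 2 / (2 - δ)) (hSP : SP μ c δ) :
    ∃ C > (0:ℝ), ∀ g : Eu d → ℝ, ContDiff ℝ (⊤ : ℕ∞) g → Integrable (Fn p g) μ → ∀ S ≥ (0:ℝ),
      S ^ p * ∫ x in {x : Eu d | S ≤ rho x}, g x ^ 2 ∂μ ≤ C * ∫ x, Fn p g x ∂μ := by
  obtain ⟨hp2, -⟩ := expo_facts hδ hp
  obtain ⟨C, hC, hH⟩ := hardy hc hδ hp hSP
  refine ⟨C, hC, ?_⟩
  intro g hg hi S hS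
  have hg2 := Fn_sq_integrable hg hi
  set T : Set (Eu d) := {x : Eu d | S ≤ rho x} with hT
  set U : ℕ → Set (Eu d) := fun N => {x : Eu d | rho x ^ 2 < (4:ℝ)^N} with hU
  have hTm : MeasurableSet T := measurableSet_Ici.preimage rho_continuous.measurable
  have hUm : ∀ N, MeasurableSet (U N) := fun N =>
    measurableSet_Iio.preimage (rho_continuous.pow 2).measurable
  have hmono : Monotone (fun N => T ∩ U N) := by
    intro a b hab x hx
    have h4 : (4:ℝ) ^ a ≤ 4 ^ b := pow_le_pow_right₀ (by norm_num) hab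
    exact ⟨hx.1, lt_of_lt_of_le hx.2 h4⟩
  have hun : ⋃ N, T ∩ U N = T := by
    ext x
    simp only [mem_iUnion, mem_inter_iff]
    constructor
    · rintro ⟨_, h, _⟩; exact h
    · intro h
      obtain ⟨N, hN⟩ := pow_unbounded_of_one_lt (rho x ^ 2) (show (1:ℝ) < 4 by norm_num)
      exact ⟨N, h, hN⟩
  have hlim := tendsto_setIntegral_of_monotone (f := fun x => g x ^ 2) (μ := μ) (s := fun N => T ∩ U N)
    (fun N => hTm.inter (hUm N)) hmono hg2.integrableOn
  rw [hun] at hlim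
  refine le_of_tendsto (hlim.const_mul (S ^ p)) (Filter.Eventually.of_forall (fun N => ?_))
  refine le_trans ?_ (hH g hg hi N)
  have hri : IntegrableOn (fun x => rho x ^ p * g x ^ 2) (U N) μ := by
    refine Integrable.mono' ((hg2.const_mul (((4:ℝ)^N)^p)).integrableOn (s := U N))
      ((rho_rpow_continuous p).mul (hg.continuous.pow 2)).aestronglyMeasurable ?_
    refine (ae_restrict_iff' (hUm N)).2 (Filter.Eventually.of_forall (fun x hx => ?_))
    have h1 := one_le_rho x
    have h2 : rho x ^ 2 < (4:ℝ)^N := hx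
    rw [Real.norm_of_nonneg (by positivity)]
    have h3 : rho x ≤ (4:ℝ)^N := by nlinarith
    gcongr
  rw [← integral_const_mul]
  calc _ ≤ ∫ x in T ∩ U N, rho x ^ p * g x ^ 2 ∂μ := by
        apply setIntegral_mono_on (hg2.const_mul _).integrableOn (hri.mono_set inter_subset_right)
          (hTm.inter (hUm N))
        intro x hx
        have : S ≤ rho x := hx.1
        gcongr
    _ ≤ _ := by
        apply setIntegral_mono_set hri
        · refine Filter.Eventually.of_forall (fun x => ?_)
          have := rho_pos x
          simp only [Pi.zero_apply]
          positivity
        · exact inter_subset_right.eventuallyLE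

lemma Fn_integrable_compact {μ : Measure (Eu d)} [IsFiniteMeasure μ] (p : ℝ) {g : Eu d → ℝ}
    (hg : ContDiff ℝ (⊤ : ℕ∞) g) (hgc : HasCompactSupport g) : Integrable (Fn p g) μ := by
  apply (Fn_continuous p hg).integrable_of_hasCompactSupport
  apply HasCompactSupport.of_support_subset_isCompact hgc
  intro x hx
  by_contra hx'
  apply hx
  have h1 : g x = 0 := image_eq_zero_of_notMem_tsupport hx'
  have h2 : fderiv ℝ g x = 0 := image_eq_zero_of_notMem_tsupport (fun h => hx' (tsupport_fderiv_subset ℝ h))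
  simp [Fn, h1, h2]

lemma level {μ : Measure (Eu d)} [IsProbabilityMeasure μ] {c δ p : ℝ} (hc : 0 < c)
    (hδ : δ ∈ Ioo (1:ℝ) 2) (hp : p = 2 / (2 - δ)) (hSP : SP μ c δ) :
    ∃ C > (0:ℝ), ∀ k : ℕ, 1 ≤ k → ∀ g : Eu d → ℝ, ContDiff ℝ (⊤ : ℕ∞) g → HasCompactSupport g →
      μ.real {x | g x ≠ 0} ≤ 2 * Real.exp (-k) →
      k * ∫ x, g x ^ 2 ∂μ ≤ C * ∫ x, Fn p g x ∂μ := by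
  obtain ⟨hp2, -⟩ := expo_facts hδ hp
  obtain ⟨C, hC, hH⟩ := hardy_tail hc hδ hp hSP
  obtain ⟨θ, hθ, hθ0, hθ1, hθe, hθz, hθd, G, hG, hθG⟩ := exists_bump 0 1 2 (by norm_num) (by norm_num)
  obtain ⟨C', hC', hcore⟩ := core hc hδ hp hSP (A := 2) (ε := 1) (by norm_num) one_pos (G := 4 * G) (by positivity)
  refine ⟨C' + C, by positivity, ?_⟩
  intro k hk g hg hgc hmeas
  have hk1 : (1:ℝ) ≤ k := by exact_mod_cast hk
  set R : ℝ := (k:ℝ) ^ (1/p) with hRdef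
  have hR1 : 1 ≤ R := Real.one_le_rpow hk1 (by positivity)
  have hRp : R ^ p = k := by
    rw [hRdef, ← Real.rpow_mul (by positivity), one_div_mul_cancel (by positivity), Real.rpow_one]
  have hR2 : 0 < R ^ 2 := by positivity
  have hi := Fn_integrable_compact (μ := μ) p hg hgc
  have hg2 := Fn_sq_integrable hg hi
  set S : Set (Eu d) := {x | rho x ^ 2 ≤ 2 * R ^ 2} with hS
  have hoff : ∀ x ∉ S, 2 ≤ |rho x ^ 2 / R ^ 2 - 0| := by
    intro x hx
    have : 2 * R ^ 2 < rho x ^ 2 := not_le.1 hx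
    rw [sub_zero, abs_of_nonneg (by positivity), le_div_iff₀ hR2]
    exact this.le
  have hSR : ∀ x ∈ S, rho x ≤ 2 * R := by
    intro x hx
    have : rho x ^ 2 ≤ 2 * R ^ 2 := hx
    refine le_of_sq_le_sq_pos ?_ (by positivity)
    nlinarith
  have h1 := hcore R hR1 (fun x => θ (rho x ^ 2 / R ^ 2)) g S (chi_contDiff hθ _) hg
    (measurableSet_Iic.preimage (rho_continuous.pow 2).measurable)
    (fun x => by rw [abs_of_nonneg (hθ0 _)]; exact hθ1 _)
    (fun x hx => hθz _ (hoff x hx))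
    (fun x hx => by
      rw [← norm_le_zero_iff]
      refine (chi_fd hθ hR2 x).trans ?_
      rw [hθd _ (hoff x hx)]; simp)
    (fun x => by
      refine (chi_fd hθ hR2 x).trans ?_
      by_cases hx : x ∈ S
      · calc _ ≤ G * (2 * (2 * R) / R ^ 2) := by
              have := rho_pos x
              gcongr
              · exact hθG _
              · exact hSR x hx
          _ = _ := by field_simp; norm_num
      · rw [hθd _ (hoff x hx)]; simp; positivity)
    (fun x hx => by have := hSR x hx; linarith)
    (by
      rw [hRp]
      refine (measureReal_mono (fun x hx => ?_)).trans (hmeas.trans (le_of_eq (by norm_num)))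
      exact right_ne_zero_of_mul hx)
  rw [hRp] at h1
  have h2 := hH g hg hi R (by positivity)
  rw [hRp] at h2
  set T : Set (Eu d) := {x : Eu d | R ≤ rho x} with hT
  have hTm : MeasurableSet T := measurableSet_Ici.preimage rho_continuous.measurable
  have hχi : Integrable (fun x => (θ (rho x ^ 2 / R ^ 2) * g x) ^ 2) μ :=
    int_sq (g := fun x => θ (rho x ^ 2 / R ^ 2) * g x)
      ((chi_contDiff hθ _).continuous.mul hg.continuous) hgc.mul_left
  have h3 : ∫ x in Tᶜ, g x ^ 2 ∂μ ≤ ∫ x, (θ (rho x ^ 2 / R ^ 2) * g x) ^ 2 ∂μ := by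
    calc _ ≤ ∫ x in Tᶜ, (θ (rho x ^ 2 / R ^ 2) * g x) ^ 2 ∂μ := by
          apply setIntegral_mono_on hg2.integrableOn hχi.integrableOn hTm.compl
          intro x hx
          have hx' : rho x < R := not_le.1 hx
          have := rho_pos x
          rw [hθe, one_mul]
          rw [sub_zero, abs_of_nonneg (by positivity), div_le_one hR2]
          gcongr
      _ ≤ _ := setIntegral_le_integral hχi (Filter.Eventually.of_forall (fun x => by
            simp only [Pi.zero_apply]
            positivity))
  have h4 : ∫ x in S, Fn p g x ∂μ ≤ ∫ x, Fn p g x ∂μ :=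
    setIntegral_le_integral hi (Filter.Eventually.of_forall (Fn_nonneg p g))
  rw [← integral_add_compl hTm hg2, mul_add]
  have h5 := mul_le_mul_of_nonneg_left h3 (show (0:ℝ) ≤ k by positivity)
  have h6 := mul_le_mul_of_nonneg_left h4 hC'.le
  linarith
end level

section poinc
variable {d : ℕ}

lemma En_integrable {μ : Measure (Eu d)} [IsFiniteMeasure μ] (q : ℝ) {g : Eu d → ℝ}
    (hg : ContDiff ℝ (⊤ : ℕ∞) g) (hgc : HasCompactSupport g) :
    Integrable (fun x => rho x ^ q * ‖fderiv ℝ g x‖ ^ 2) μ := by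
  have h1 : Continuous (fderiv ℝ g) := hg.continuous_fderiv (by simp)
  have h2 : Continuous (fun x => rho x ^ q * ‖fderiv ℝ g x‖ ^ 2) :=
    (rho_rpow_continuous _).mul (h1.norm.pow 2)
  apply h2.integrable_of_hasCompactSupport
  apply HasCompactSupport.of_support_subset_isCompact hgc
  intro x hx
  by_contra hx'
  apply hx
  have h2 : fderiv ℝ g x = 0 := image_eq_zero_of_notMem_tsupport (fun h => hx' (tsupport_fderiv_subset ℝ h))
  simp [h2]

lemma poincare {V : Eu d → ℝ} (hV : Continuous V) {μ : Measure (Eu d)} [IsProbabilityMeasure μ]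
    (hμ : μ = volume.withDensity (fun x => ENNReal.ofReal (Real.exp (V x)))) {c δ p : ℝ} (hc : 0 < c)
    (hδ : δ ∈ Ioo (1:ℝ) 2) (hp : p = 2 / (2 - δ)) (hSP : SP μ c δ) :
    ∃ C > (0:ℝ), ∀ f : Eu d → ℝ, ContDiff ℝ (⊤ : ℕ∞) f → HasCompactSupport f → ∃ m : ℝ,
      ∫ x, (f x - m) ^ 2 ∂μ ≤ C * ∫ x, rho x ^ (-(p-2)) * ‖fderiv ℝ f x‖ ^ 2 ∂μ := by
  obtain ⟨hp2, -⟩ := expo_facts hδ hp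
  obtain ⟨C, hC, hH⟩ := hardy_tail hc hδ hp hSP
  set S : ℝ := max 1 (2 * C) with hS
  have hS1 : 1 ≤ S := le_max_left _ _
  have hSp : 2 * C ≤ S ^ p := by
    calc 2 * C ≤ S := le_max_right _ _
      _ = S ^ (1:ℝ) := (Real.rpow_one _).symm
      _ ≤ S ^ p := Real.rpow_le_rpow_of_exponent_le hS1 (by linarith)
  obtain ⟨L, hL, hloc⟩ := local_poincare hV hμ (S := S) (by linarith)
  refine ⟨1 + 2 * (L * (1 + S) ^ (p - 2)), by positivity, ?_⟩
  intro f hf hfc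
  obtain ⟨m, hm⟩ := hloc f hf
  refine ⟨m, ?_⟩
  have hE := En_integrable (μ := μ) (-(p-2)) hf hfc
  set E := ∫ x, rho x ^ (-(p-2)) * ‖fderiv ℝ f x‖ ^ 2 ∂μ with hEdef
  have hfi : Integrable f μ := hf.continuous.integrable_of_hasCompactSupport hfc
  have hf2 := int_sq (μ := μ) hf.continuous hfc
  have hg2 : Integrable (fun x => (f x - m) ^ 2) μ := by
    have : (fun x => (f x - m) ^ 2) = fun x => f x ^ 2 - 2 * m * f x + m ^ 2 := by ext x; ring
    rw [this]
    exact (hf2.sub (hfi.const_mul _)).add (integrable_const _)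
  have hg : ContDiff ℝ (⊤ : ℕ∞) (fun x => f x - m) := hf.sub contDiff_const
  have hFn : Fn p (fun x => f x - m) = fun x => rho x ^ (-(p-2)) * ‖fderiv ℝ f x‖ ^ 2 + (f x - m) ^ 2 := by
    ext x; simp only [Fn, fderiv_sub_const]
  have hi : Integrable (Fn p (fun x => f x - m)) μ := by rw [hFn]; exact hE.add hg2
  have hFi : ∫ x, Fn p (fun x => f x - m) x ∂μ = E + ∫ x, (f x - m) ^ 2 ∂μ := by
    rw [hFn]; exact integral_add hE hg2
  have h1 := hH _ hg hi S (by linarith)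
  rw [hFi] at h1
  set T : Set (Eu d) := {x : Eu d | S ≤ rho x} with hT
  have hTm : MeasurableSet T := measurableSet_Ici.preimage rho_continuous.measurable
  have hX0 : 0 ≤ ∫ x in T, (f x - m) ^ 2 ∂μ := integral_nonneg (fun x => by positivity)
  have h2 : ∫ x in T, (f x - m) ^ 2 ∂μ ≤ (E + ∫ x, (f x - m) ^ 2 ∂μ) / 2 := by
    have := mul_le_mul_of_nonneg_right hSp hX0
    have h3 : C * (2 * ∫ x in T, (f x - m) ^ 2 ∂μ) ≤ C * (E + ∫ x, (f x - m) ^ 2 ∂μ) := by linarith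
    have := le_of_mul_le_mul_left h3 hC
    linarith
  have h3 : ∫ x in Tᶜ, (f x - m) ^ 2 ∂μ ≤ ∫ x in Metric.closedBall (0 : Eu d) S, (f x - m) ^ 2 ∂μ := by
    apply setIntegral_mono_set hg2.integrableOn
    · exact Filter.Eventually.of_forall (fun x => by simp only [Pi.zero_apply]; positivity)
    · refine LE.le.eventuallyLE (show Tᶜ ⊆ Metric.closedBall (0 : Eu d) S from fun x hx => ?_)
      have hx' : rho x < S := not_le.1 hx
      rw [mem_closedBall_zero_iff]
      exact (norm_le_rho x).trans hx'.le
  have h4 : ∫ x in Metric.closedBall (0 : Eu d) S, ‖fderiv ℝ f x‖ ^ 2 ∂μ ≤ (1 + S) ^ (p - 2) * E := by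
    rw [hEdef, ← integral_const_mul]
    refine le_trans ?_ (setIntegral_le_integral (s := Metric.closedBall (0 : Eu d) S) (hE.const_mul _) ?_)
    · apply integral_mono_of_nonneg
      · exact Filter.Eventually.of_forall (fun x => by simp only [Pi.zero_apply]; positivity)
      · exact (hE.const_mul _).integrableOn
      · refine (ae_restrict_iff' Metric.isClosed_closedBall.measurableSet).2 (Filter.Eventually.of_forall (fun x hx => ?_))
        rw [mem_closedBall_zero_iff] at hx
        have hr := rho_pos x
        have hr1 : rho x ≤ 1 + S := (rho_le x).trans (by linarith)
        have h5 : 1 ≤ (1 + S) ^ (p - 2) * rho x ^ (-(p-2)) := by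
          rw [Real.rpow_neg hr.le, ← div_eq_mul_inv, one_le_div (by positivity)]
          exact Real.rpow_le_rpow hr.le hr1 (by linarith)
        have h6 := mul_le_mul_of_nonneg_right h5 (sq_nonneg ‖fderiv ℝ f x‖)
        show ‖fderiv ℝ f x‖ ^ 2 ≤ (1 + S) ^ (p - 2) * (rho x ^ (-(p-2)) * ‖fderiv ℝ f x‖ ^ 2)
        linarith
    · exact Filter.Eventually.of_forall (fun x => by
        have hr := rho_pos x
        simp only [Pi.zero_apply]; positivity)
  have h5 := integral_add_compl hTm hg2
  have h6 := mul_le_mul_of_nonneg_left h4 hL.le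
  linarith

lemma dist_abs_one {μ : Measure (Eu d)} [IsProbabilityMeasure μ] {f : Eu d → ℝ} (hf : Continuous f)
    (hfc : HasCompactSupport f) (h1 : ∫ x, f x ^ 2 ∂μ = 1) (m : ℝ) :
    Integrable (fun x => (|f x| - 1) ^ 2) μ ∧ ∫ x, (|f x| - 1) ^ 2 ∂μ ≤ 2 * ∫ x, (f x - m) ^ 2 ∂μ := by
  have hfi : Integrable f μ := hf.integrable_of_hasCompactSupport hfc
  have hf2 := int_sq (μ := μ) hf hfc
  have e1 : (fun x => (|f x| - 1) ^ 2) = fun x => f x ^ 2 - 2 * |f x| + 1 := by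
    ext x; rw [← sq_abs (f x)]; ring
  have e2 : (fun x => (f x - m) ^ 2) = fun x => f x ^ 2 - 2 * m * f x + m ^ 2 := by ext x; ring
  have i1 : Integrable (fun x => f x ^ 2 - 2 * |f x|) μ := hf2.sub (hfi.abs.const_mul 2)
  have i2 : Integrable (fun x => f x ^ 2 - 2 * m * f x) μ := hf2.sub (hfi.const_mul (2 * m))
  have hi : Integrable (fun x => (|f x| - 1) ^ 2) μ := by
    rw [e1]; exact i1.add (integrable_const _)
  refine ⟨hi, ?_⟩
  have v1 : ∫ x, (|f x| - 1) ^ 2 ∂μ = 2 - 2 * ∫ x, |f x| ∂μ := by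
    rw [e1, integral_add i1 (integrable_const _), integral_sub hf2 (hfi.abs.const_mul 2), h1, integral_const_mul]
    simp; ring
  have v2 : ∫ x, (f x - m) ^ 2 ∂μ = 1 - 2 * m * ∫ x, f x ∂μ + m ^ 2 := by
    rw [e2, integral_add i2 (integrable_const _), integral_sub hf2 (hfi.const_mul (2 * m)), h1, integral_const_mul]
    simp
  have n1 : 0 ≤ ∫ x, (|f x| - 1) ^ 2 ∂μ := integral_nonneg (fun x => by positivity)
  have n2 : |∫ x, f x ∂μ| ≤ ∫ x, |f x| ∂μ := abs_integral_le_integral_abs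
  rw [v1] at n1 ⊢
  rw [v2]
  set a := ∫ x, f x ∂μ
  set b := ∫ x, |f x| ∂μ
  have hb0 : 0 ≤ b := (abs_nonneg _).trans n2
  have hab : a ^ 2 ≤ b ^ 2 := by rw [← sq_abs a]; gcongr
  nlinarith [sq_nonneg (m - a)]
end poinc

section entropy
variable {d : ℕ}

lemma ent_pt {θ : ℝ → ℝ} (hθe : ∀ t, |t - 5/2| ≤ 3/2 → θ t = 1) {N : ℕ} {t : ℝ} (ht : t ^ 2 < (4:ℝ)^N) :
    t ^ 2 * Real.log (t ^ 2) ≤ t ^ 2 - 1 + 9 * (|t| - 1) ^ 2 +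
      16 * ∑ k ∈ Finset.range N, (k:ℝ) * (2 ^ k * θ (t ^ 2 / 4 ^ k)) ^ 2 := by
  have hsum : 0 ≤ ∑ k ∈ Finset.range N, (k:ℝ) * (2 ^ k * θ (t ^ 2 / 4 ^ k)) ^ 2 :=
    Finset.sum_nonneg (fun k _ => by positivity)
  have hsa := sq_abs t
  have ha := abs_nonneg t
  rcases lt_or_ge (t ^ 2) 4 with h4 | h4
  · have h1 : t ^ 2 * Real.log (t ^ 2) ≤ t ^ 2 - 1 + 9 * (|t| - 1) ^ 2 := by
      rcases eq_or_ne t 0 with rfl | h0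
      · simp
      · have hl := Real.log_le_sub_one_of_pos (show 0 < t ^ 2 by positivity)
        have h2 := mul_le_mul_of_nonneg_left hl (sq_nonneg t)
        have h3 : |t| ≤ 2 := by nlinarith
        have h5 : (|t| + 1) ^ 2 ≤ 9 := by nlinarith
        have h6 := mul_le_mul_of_nonneg_left h5 (sq_nonneg (|t| - 1))
        have h7 : (|t| - 1) ^ 2 * (|t| + 1) ^ 2 = (t ^ 2 - 1) ^ 2 := by
          rw [← hsa]; ring
        nlinarith
    linarith
  · obtain ⟨n, hn1, hn2⟩ := exists_nat_pow_near (show 1 ≤ t ^ 2 by linarith) (show (1:ℝ) < 4 by norm_num)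
    have hnN : n < N := by
      by_contra hcon
      push Not at hcon
      have : (4:ℝ)^N ≤ 4^n := pow_le_pow_right₀ (by norm_num) hcon
      linarith
    have h4n : (0:ℝ) < 4 ^ n := by positivity
    have hn0 : 1 ≤ n := by
      by_contra hcon
      have : n = 0 := by omega
      subst this
      norm_num at hn2
      linarith
    have hn1' : (1:ℝ) ≤ n := by exact_mod_cast hn0
    have hle := Finset.single_le_sum (f := fun k : ℕ => (k:ℝ) * (2 ^ k * θ (t ^ 2 / 4 ^ k)) ^ 2)
      (fun i _ => by positivity) (Finset.mem_range.2 hnN)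
    have hone : θ (t ^ 2 / 4 ^ n) = 1 := by
      apply hθe
      have a1 : 1 ≤ t ^ 2 / 4 ^ n := by rw [le_div_iff₀ h4n]; linarith
      have a2 : t ^ 2 / 4 ^ n ≤ 4 := by
        rw [div_le_iff₀ h4n]
        rw [pow_succ (4:ℝ) n] at hn2
        linarith
      rw [abs_le]; constructor <;> linarith
    have hsq : ((2:ℝ) ^ n) ^ 2 = 4 ^ n := by
      rw [← pow_mul, mul_comm, pow_mul]; norm_num
    simp only [hone, mul_one, hsq] at hle
    have hlog4 : Real.log 4 ≤ 2 := by
      rw [show (4:ℝ) = 2 ^ 2 by norm_num, Real.log_pow]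
      have := Real.log_two_lt_d9
      push_cast
      linarith
    have hlog : Real.log (t ^ 2) ≤ 4 * n := by
      calc Real.log (t ^ 2) ≤ Real.log (4 ^ (n+1)) := Real.log_le_log (by linarith) hn2.le
        _ = (n + 1) * Real.log 4 := by rw [Real.log_pow]; push_cast; ring
        _ ≤ (n + 1) * 2 := by gcongr
        _ ≤ 4 * n := by linarith
    have hfin : t ^ 2 * Real.log (t ^ 2) ≤ 16 * (n * 4 ^ n) := by
      calc t ^ 2 * Real.log (t ^ 2) ≤ 4 ^ (n+1) * (4 * n) :=
            mul_le_mul hn2.le hlog (Real.log_nonneg (by linarith)) (by positivity)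
        _ = _ := by ring
    have : 0 ≤ (|t| - 1) ^ 2 := sq_nonneg _
    linarith

lemma fd_level {θ : ℝ → ℝ} (hθ : ContDiff ℝ (⊤ : ℕ∞) θ) {f : Eu d → ℝ} (hf : ContDiff ℝ (⊤ : ℕ∞) f)
    (k : ℕ) (x : Eu d) :
    ‖fderiv ℝ (fun y => 2 ^ k * θ (f y ^ 2 / 4 ^ k)) x‖ =
      2 ^ k * |deriv θ (f x ^ 2 / 4 ^ k)| * (2 * |f x| / 4 ^ k) * ‖fderiv ℝ f x‖ := by
  have hΘ : ContDiff ℝ (⊤ : ℕ∞) (fun t : ℝ => (2:ℝ) ^ k * θ (t ^ 2 / 4 ^ k)) :=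
    contDiff_const.mul (hθ.comp ((contDiff_id.pow 2).div_const _))
  rw [norm_fderiv_comp (θ := fun t : ℝ => (2:ℝ) ^ k * θ (t ^ 2 / 4 ^ k)) hΘ hf x]
  congr 1
  have h1 : HasDerivAt (fun t : ℝ => t ^ 2 / (4:ℝ) ^ k) (2 * f x / 4 ^ k) (f x) := by
    have := (hasDerivAt_pow 2 (f x)).div_const ((4:ℝ)^k)
    simpa using this
  have h2 : HasDerivAt θ (deriv θ (f x ^ 2 / 4 ^ k)) (f x ^ 2 / 4 ^ k) :=
    (hθ.differentiable (by simp) _).hasDerivAt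
  have h3 := (h2.comp (f x) h1).const_mul ((2:ℝ)^k)
  have h4 : deriv (fun t : ℝ => (2:ℝ) ^ k * θ (t ^ 2 / 4 ^ k)) (f x) =
    (2:ℝ)^k * (deriv θ (f x ^ 2 / 4 ^ k) * (2 * f x / 4 ^ k)) := h3.deriv
  rw [h4]
  simp only [abs_mul, abs_div, abs_pow, Nat.abs_ofNat]
  ring

set_option maxHeartbeats 1000000 in
lemma entropy {V : Eu d → ℝ} (hV : Continuous V) {μ : Measure (Eu d)} [IsProbabilityMeasure μ]
    (hμ : μ = volume.withDensity (fun x => ENNReal.ofReal (Real.exp (V x)))) {c δ p : ℝ} (hc : 0 < c)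
    (hδ : δ ∈ Ioo (1:ℝ) 2) (hp : p = 2 / (2 - δ)) (hSP : SP μ c δ) :
    ∃ C > (0:ℝ), ∀ f : Eu d → ℝ, ContDiff ℝ (⊤ : ℕ∞) f → HasCompactSupport f →
      ∫ x, f x ^ 2 ∂μ = 1 → ∫ x, f x ^ 2 * Real.log (f x ^ 2) ∂μ ≤
        C * ∫ x, rho x ^ (-(p-2)) * ‖fderiv ℝ f x‖ ^ 2 ∂μ := by
  obtain ⟨P, hP, hpoin⟩ := poincare hV hμ hc hδ hp hSP
  obtain ⟨L, hL, hlev⟩ := level hc hδ hp hSP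
  obtain ⟨θ, hθ, hθ0, hθ1, hθe, hθz, hθd, G, hG, hθG⟩ := exists_bump (5/2) (3/2) 2 (by norm_num) (by norm_num)
  set K : ℝ := 36 * G ^ 2 + 32 with hK
  refine ⟨9 * (2 * P) + 16 * (L * (K * (2 * (1 + 2 * P)))), by positivity, ?_⟩
  intro f hf hfc hf1
  obtain ⟨m, hm⟩ := hpoin f hf hfc
  obtain ⟨hDi, hD⟩ := dist_abs_one hf.continuous hfc hf1 m
  have hE := En_integrable (μ := μ) (-(p-2)) hf hfc
  set E := ∫ x, rho x ^ (-(p-2)) * ‖fderiv ℝ f x‖ ^ 2 ∂μ with hEdef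
  set D := ∫ x, (|f x| - 1) ^ 2 ∂μ with hDdef
  have hDE : D ≤ 2 * P * E := by linarith
  have hf2 := int_sq (μ := μ) hf.continuous hfc
  set F : Eu d → ℝ := fun x => rho x ^ (-(p-2)) * ‖fderiv ℝ f x‖ ^ 2 + (|f x| - 1) ^ 2 with hF
  have hF0 : ∀ x, 0 ≤ F x := fun x => by
    have := rho_pos x
    simp only [hF]; positivity
  have hFi : Integrable F μ := hE.add hDi
  have hFv : ∫ x, F x ∂μ = E + D := integral_add hE hDi
  -- bound on f
  obtain ⟨N, hN⟩ : ∃ N : ℕ, ∀ x, f x ^ 2 < (4:ℝ)^N := by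
    obtain ⟨B, hB⟩ := hf.continuous.bounded_above_of_compact_support hfc
    obtain ⟨N, hN⟩ := pow_unbounded_of_one_lt (B ^ 2) (show (1:ℝ) < 4 by norm_num)
    refine ⟨N, fun x => lt_of_le_of_lt ?_ hN⟩
    have := hB x
    rw [Real.norm_eq_abs] at this
    rw [← sq_abs]
    gcongr
  have hsq : ∀ n : ℕ, (4:ℝ)^n = (2 ^ n) ^ 2 := by
    intro n; rw [← pow_mul, mul_comm, pow_mul]; norm_num
  have hzero : ∀ (n : ℕ) (x : Eu d), f x ^ 2 ∉ Icc ((4:ℝ)^n/2) (9/2*4^n) →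
      2 ≤ |f x ^ 2 / 4 ^ n - 5/2| := by
    intro n x hx
    have h4 : (0:ℝ) < 4 ^ n := by positivity
    rw [mem_Icc, not_and_or, not_le, not_le] at hx
    rw [le_abs]
    rcases hx with hx | hx
    · right
      have : f x ^ 2 / 4 ^ n < 1 / 2 := by rw [div_lt_iff₀ h4]; linarith
      linarith
    · left
      have : 9 / 2 < f x ^ 2 / 4 ^ n := by rw [lt_div_iff₀ h4]; linarith
      linarith
  have hgsm : ∀ k : ℕ, ContDiff ℝ (⊤ : ℕ∞) (fun y => 2 ^ k * θ (f y ^ 2 / 4 ^ k)) := fun k =>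
    contDiff_const.mul (hθ.comp ((hf.pow 2).div_const _))
  have hgcs : ∀ k : ℕ, HasCompactSupport (fun y => 2 ^ k * θ (f y ^ 2 / 4 ^ k)) := fun k =>
    hfc.comp_left (g := fun t : ℝ => 2 ^ k * θ (t ^ 2 / 4 ^ k)) (by
      rw [hθz]
      · simp
      · norm_num [abs_of_neg])
  have hSm : ∀ k : ℕ, MeasurableSet {x : Eu d | f x ^ 2 ∈ Icc ((4:ℝ)^k/2) (9/2*4^k)} := fun k =>
    measurableSet_Icc.preimage (hf.continuous.pow 2).measurable
  have hstep : ∀ k : ℕ, (k:ℝ) * ∫ x, (2 ^ k * θ (f x ^ 2 / 4 ^ k)) ^ 2 ∂μ ≤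
      L * (K * ∫ x in {x : Eu d | f x ^ 2 ∈ Icc ((4:ℝ)^k/2) (9/2*4^k)}, F x ∂μ) := by
    intro k
    have hFS : 0 ≤ ∫ x in {x : Eu d | f x ^ 2 ∈ Icc ((4:ℝ)^k/2) (9/2*4^k)}, F x ∂μ :=
      integral_nonneg hF0
    rcases Nat.eq_zero_or_pos k with hk | hk
    · rw [hk] at hFS ⊢
      simp only [Nat.cast_zero, zero_mul]
      positivity
    have h4 : (0:ℝ) < 4 ^ k := by positivity
    have h44 : (4:ℝ) ≤ 4 ^ k := by
      calc (4:ℝ) = 4 ^ 1 := (pow_one _).symm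
        _ ≤ 4 ^ k := pow_le_pow_right₀ (by norm_num) hk
    have hmeas : μ.real {x | 2 ^ k * θ (f x ^ 2 / 4 ^ k) ≠ 0} ≤ 2 * Real.exp (-k) := by
      have hsub : {x | 2 ^ k * θ (f x ^ 2 / 4 ^ k) ≠ 0} ⊆ {x | (4:ℝ)^k / 2 ≤ f x ^ 2} := by
        intro x hx
        by_contra hcon
        apply hx
        rw [hθz, mul_zero]
        apply hzero
        intro hI
        exact hcon hI.1
      have hmk := mul_meas_ge_le_integral_of_nonneg (μ := μ) (f := fun x => f x ^ 2)
        (Filter.Eventually.of_forall (fun x => sq_nonneg (f x))) hf2 ((4:ℝ)^k / 2)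
      rw [hf1] at hmk
      have hmm := measureReal_mono (μ := μ) hsub
      have hexp : Real.exp k ≤ 4 ^ k := by
        calc Real.exp k = Real.exp 1 ^ k := by rw [← Real.exp_nat_mul, mul_one]
          _ ≤ 4 ^ k := by
            have := Real.exp_one_lt_d9
            gcongr
            linarith
      have h5 : μ.real {x | (4:ℝ)^k / 2 ≤ f x ^ 2} * Real.exp k ≤ 2 := by
        have h6 : μ.real {x | (4:ℝ)^k / 2 ≤ f x ^ 2} * Real.exp k ≤
          μ.real {x | (4:ℝ)^k / 2 ≤ f x ^ 2} * 4 ^ k := by gcongr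
        have h7 : (4:ℝ)^k / 2 * μ.real {x | (4:ℝ)^k / 2 ≤ f x ^ 2} ≤ 1 := hmk
        linarith
      refine hmm.trans ?_
      rw [Real.exp_neg, ← div_eq_mul_inv, le_div_iff₀ (Real.exp_pos _)]
      exact h5
    refine (hlev k hk _ (hgsm k) (hgcs k) hmeas).trans ?_
    gcongr
    rw [← integral_indicator (hSm k), ← integral_const_mul]
    apply integral_mono (Fn_integrable_compact p (hgsm k) (hgcs k))
      ((hFi.indicator (hSm k)).const_mul K)
    intro x
    show Fn p _ x ≤ K * indicator _ F x
    by_cases hx : f x ^ 2 ∈ Icc ((4:ℝ)^k/2) (9/2*4^k)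
    · rw [indicator_of_mem (s := {x : Eu d | f x ^ 2 ∈ Icc ((4:ℝ)^k/2) (9/2*4^k)}) hx]
      have hr := rho_pos x
      have hsa := sq_abs (f x)
      have ha := abs_nonneg (f x)
      have h2k : (0:ℝ) < 2 ^ k := by positivity
      have hfb : |f x| ≤ 3 * 2 ^ k := by
        refine le_of_sq_le_sq_pos ?_ (by positivity)
        have := hx.2
        rw [hsq] at this
        rw [hsa]
        nlinarith
      have hgr : ‖fderiv ℝ (fun y => 2 ^ k * θ (f y ^ 2 / 4 ^ k)) x‖ ≤ 6 * G * ‖fderiv ℝ f x‖ := by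
        rw [fd_level hθ hf]
        refine mul_le_mul_of_nonneg_right ?_ (norm_nonneg _)
        calc 2 ^ k * |deriv θ (f x ^ 2 / 4 ^ k)| * (2 * |f x| / 4 ^ k)
            ≤ 2 ^ k * G * (2 * (3 * 2 ^ k) / 4 ^ k) := by
              have := hθG (f x ^ 2 / 4 ^ k)
              gcongr
          _ = 6 * G := by rw [hsq]; field_simp; norm_num
      have hv : (2 ^ k * θ (f x ^ 2 / 4 ^ k)) ^ 2 ≤ 32 * (|f x| - 1) ^ 2 := by
        have h5 : (2 ^ k * θ (f x ^ 2 / 4 ^ k)) ^ 2 ≤ 4 ^ k := by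
          have t1 := hθ1 (f x ^ 2 / 4 ^ k)
          have t0 := hθ0 (f x ^ 2 / 4 ^ k)
          rw [mul_pow, ← hsq k]
          exact mul_le_of_le_one_right h4.le (pow_le_one₀ t0 t1)
        have h6 := hx.1
        have h7 : 4 / 3 ≤ |f x| := by
          refine le_of_sq_le_sq_pos ?_ ha
          rw [hsa]; linarith
        nlinarith
      have hg2 : ‖fderiv ℝ (fun y => 2 ^ k * θ (f y ^ 2 / 4 ^ k)) x‖ ^ 2 ≤ 36 * G ^ 2 * ‖fderiv ℝ f x‖ ^ 2 := by
        calc _ ≤ (6 * G * ‖fderiv ℝ f x‖) ^ 2 := by gcongr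
          _ = _ := by ring
      have hw : 0 < rho x ^ (-(p-2)) := by positivity
      have h8 := mul_le_mul_of_nonneg_left hg2 hw.le
      simp only [Fn, hF, hK]
      have h9 : 0 ≤ rho x ^ (-(p-2)) * ‖fderiv ℝ f x‖ ^ 2 := by positivity
      have h10 : 0 ≤ G ^ 2 * (|f x| - 1) ^ 2 := by positivity
      nlinarith
    · rw [indicator_of_notMem (s := {x : Eu d | f x ^ 2 ∈ Icc ((4:ℝ)^k/2) (9/2*4^k)}) hx]
      have h5 : ‖fderiv ℝ (fun y => 2 ^ k * θ (f y ^ 2 / 4 ^ k)) x‖ = 0 := by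
        rw [fd_level hθ hf, hθd _ (hzero k x hx)]; simp
      simp only [Fn, h5, hθz _ (hzero k x hx)]
      simp
  have hgi : ∀ k ∈ Finset.range N, Integrable (fun x => (k:ℝ) * (2 ^ k * θ (f x ^ 2 / 4 ^ k)) ^ 2) μ :=
    fun k _ => (int_sq (hgsm k).continuous (hgcs k)).const_mul _
  have hSi : Integrable (fun x => ∑ k ∈ Finset.range N, (k:ℝ) * (2 ^ k * θ (f x ^ 2 / 4 ^ k)) ^ 2) μ :=
    integrable_finsetSum _ hgi
  have hSv : ∫ x, ∑ k ∈ Finset.range N, (k:ℝ) * (2 ^ k * θ (f x ^ 2 / 4 ^ k)) ^ 2 ∂μ ≤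
      L * (K * (2 * (E + D))) := by
    rw [integral_finsetSum _ hgi]
    calc _ = ∑ k ∈ Finset.range N, (k:ℝ) * ∫ x, (2 ^ k * θ (f x ^ 2 / 4 ^ k)) ^ 2 ∂μ := by
          apply Finset.sum_congr rfl
          intro k _
          rw [integral_const_mul]
      _ ≤ ∑ k ∈ Finset.range N, L * (K * ∫ x in {x : Eu d | f x ^ 2 ∈ Icc ((4:ℝ)^k/2) (9/2*4^k)}, F x ∂μ) :=
          Finset.sum_le_sum (fun k _ => hstep k)
      _ = L * (K * ∑ k ∈ Finset.range N, ∫ x in {x : Eu d | f x ^ 2 ∈ Icc ((4:ℝ)^k/2) (9/2*4^k)}, F x ∂μ) := by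
          rw [Finset.mul_sum, Finset.mul_sum]
      _ ≤ L * (K * (2 * ∫ x, F x ∂μ)) := by
          gcongr
          exact sum_overlap (u := fun x => f x ^ 2) hF0 hFi (hf.continuous.pow 2) N
      _ = _ := by rw [hFv]
  have hli : Integrable (fun x => f x ^ 2 * Real.log (f x ^ 2)) μ := by
    have h1 : Continuous (fun x => f x ^ 2 * Real.log (f x ^ 2)) :=
      Real.continuous_mul_log.comp (hf.continuous.pow 2)
    exact h1.integrable_of_hasCompactSupport
      (hfc.comp_left (g := fun t : ℝ => t ^ 2 * Real.log (t ^ 2)) (by simp))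
  have i1 : Integrable (fun x => f x ^ 2 - 1) μ := hf2.sub (integrable_const _)
  have i2 : Integrable (fun x => f x ^ 2 - 1 + 9 * (|f x| - 1) ^ 2) μ := i1.add (hDi.const_mul 9)
  have hmain : ∫ x, f x ^ 2 * Real.log (f x ^ 2) ∂μ ≤
      ∫ x, (f x ^ 2 - 1 + 9 * (|f x| - 1) ^ 2 +
        16 * ∑ k ∈ Finset.range N, (k:ℝ) * (2 ^ k * θ (f x ^ 2 / 4 ^ k)) ^ 2) ∂μ := by
    apply integral_mono hli (i2.add (hSi.const_mul 16))
    intro x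
    exact ent_pt hθe (hN x)
  rw [integral_add i2 (hSi.const_mul 16), integral_add i1 (hDi.const_mul 9),
    integral_sub hf2 (integrable_const _), hf1, integral_const_mul, integral_const_mul] at hmain
  simp only [integral_const, probReal_univ, smul_eq_mul, mul_one, sub_self, zero_add] at hmain
  have hLK : 0 < L * (K * 2) := by positivity
  have h1 : L * (K * (2 * (E + D))) ≤ L * (K * (2 * ((1 + 2 * P) * E))) := by
    have : L * (K * 2) * (E + D) ≤ L * (K * 2) * ((1 + 2 * P) * E) := by
      gcongr
      linarith
    linarith
  linarith
end entropy


theorem stmt3 (d : ℕ) (δ : ℝ) (hδ : δ ∈ Ioo (1:ℝ) 2)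
    (V : EuclideanSpace ℝ (Fin d) → ℝ) (hV : Continuous V)
    (hV1 : ∫ x, Real.exp (V x) = 1)
    (μ : Measure (EuclideanSpace ℝ (Fin d)))
    (hμ : μ = volume.withDensity (fun x => ENNReal.ofReal (Real.exp (V x))))
    (c : ℝ) (hc : 0 < c)
    (hSP : ∀ r > (0:ℝ), ∀ f : EuclideanSpace ℝ (Fin d) → ℝ,
      ContDiff ℝ (⊤ : ℕ∞) f → HasCompactSupport f →
      ∫ x, f x ^ 2 ∂μ ≤ r * ∫ x, ‖gradient f x‖ ^ 2 ∂μ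
        + Real.exp (c * (1 + r ^ (-(1:ℝ)/δ))) * (∫ x, |f x| ∂μ) ^ 2) :
    ∃ C > (0:ℝ), ∀ f : EuclideanSpace ℝ (Fin d) → ℝ,
      ContDiff ℝ (⊤ : ℕ∞) f → HasCompactSupport f → ∫ x, f x ^ 2 ∂μ = 1 →
      ∫ x, f x ^ 2 * Real.log (f x ^ 2) ∂μ ≤
        C * ∫ x, (1 + ‖x‖) ^ (-(2 * (δ - 1)) / (2 - δ)) * ‖gradient f x‖ ^ 2 ∂μ := by
  have hVi : Integrable (fun x => Real.exp (V x)) := by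
    by_contra h
    rw [integral_undef h] at hV1
    exact zero_ne_one hV1
  have hprob : IsProbabilityMeasure μ := by
    constructor
    rw [hμ, withDensity_apply _ MeasurableSet.univ, Measure.restrict_univ,
      ← ofReal_integral_eq_lintegral_ofReal hVi (Filter.Eventually.of_forall (fun x => (Real.exp_pos _).le)),
      hV1, ENNReal.ofReal_one]
  have hSP' : SP μ c δ := by
    intro r hr f hf hfc
    have := hSP r hr f hf hfc
    simpa only [norm_gradient] using this
  set p : ℝ := 2 / (2 - δ) with hp
  obtain ⟨hp2, -⟩ := expo_facts hδ hp
  obtain ⟨C, hC, h⟩ := entropy hV hμ hc hδ hp hSP'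
  have hexp : -(2 * (δ - 1)) / (2 - δ) = -(p - 2) := by
    have : 2 - δ ≠ 0 := by have := hδ.2; linarith
    rw [hp]; field_simp; ring
  refine ⟨C * 2 ^ (p - 2), by positivity, ?_⟩
  intro f hf hfc hf1
  refine (h f hf hfc hf1).trans ?_
  rw [mul_assoc]
  have hd1 : Continuous (fderiv ℝ f) := hf.continuous_fderiv (by simp)
  have hcont : Continuous (fun x : Eu d => 2 ^ (p - 2) * ((1 + ‖x‖) ^ (-(p - 2)) * ‖fderiv ℝ f x‖ ^ 2)) := by
    have h1 : Continuous (fun x : Eu d => (1 + ‖x‖) ^ (-(p - 2))) :=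
      (continuous_const.add continuous_norm).rpow_const (fun x => Or.inl (by
        have := norm_nonneg x
        have h2 : 0 < 1 + ‖x‖ := by linarith
        exact h2.ne'))
    exact continuous_const.mul (h1.mul (hd1.norm.pow 2))
  have hFint : Integrable (fun x : Eu d => 2 ^ (p - 2) * ((1 + ‖x‖) ^ (-(p - 2)) * ‖fderiv ℝ f x‖ ^ 2)) μ := by
    apply hcont.integrable_of_hasCompactSupport
    apply HasCompactSupport.of_support_subset_isCompact hfc
    intro x hx
    by_contra hx'
    apply hx
    have h2 : fderiv ℝ f x = 0 :=
      image_eq_zero_of_notMem_tsupport (fun h => hx' (tsupport_fderiv_subset ℝ h))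
    simp [h2]
  refine mul_le_mul_of_nonneg_left ?_ hC.le
  simp only [norm_gradient, hexp]
  rw [← integral_const_mul]
  apply integral_mono (En_integrable _ hf hfc) hFint
  intro x
  show rho x ^ (-(p-2)) * ‖fderiv ℝ f x‖ ^ 2 ≤ 2 ^ (p - 2) * ((1 + ‖x‖) ^ (-(p - 2)) * ‖fderiv ℝ f x‖ ^ 2)
  rw [← mul_assoc]
  refine mul_le_mul_of_nonneg_right ?_ (by positivity)
  have hr := rho_pos x
  have h1 := one_add_norm_le x
  have hn : 0 < 1 + ‖x‖ := by positivity
  rw [Real.rpow_neg hr.le, Real.rpow_neg hn.le, ← div_eq_mul_inv, ← Real.div_rpow (by norm_num) hn.le,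
    ← Real.inv_rpow hr.le]
  apply Real.rpow_le_rpow (by positivity) _ (by linarith)
  rw [inv_le_iff_one_le_mul₀ hr, div_mul_eq_mul_div, le_div_iff₀ hn]
  linarith
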